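/- arXiv:1512.09340 — 2 statements merged into one kernel-verified Lean document; each statement's English description precedes it below -/
import Mathlib

section
/- There exist a σ-finite measure space (X,μ) with μ nonatomic and μ(X) = ∞, and an invertible measure-preserving transformation T of (X,μ), such that: (i) T is weak doubly ergodic; (ii) T is at least 1/2-partially rigid; (iii) for every k ≥ 1 the k-fold Cartesian product T × ⋯ × T is conservative with respect to the k-fold product measure; and (iv) the Cartesian square T × T is not ergodic with respect to μ × μ. -/
open MeasureTheory Filter Set
open scoped ENNReal

/-- `T` is weak doubly ergodic with respect to `μ`. -/
def WDE {X : Type*} [MeasurableSpace X] (μ : Measure X) (T : X → X) : Prop :=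
  ∀ A B : Set X, MeasurableSet A → MeasurableSet B → 0 < μ A → 0 < μ B →
    ∃ n : ℕ, 1 ≤ n ∧ 0 < μ (A ∩ T^[n] '' A) ∧ 0 < μ (B ∩ T^[n] '' A)

/-- `R` is conservative with respect to `ν`. -/
def IsConservative {Y : Type*} [MeasurableSpace Y] (ν : Measure Y) (R : Y → Y) : Prop :=
  ∀ A : Set Y, MeasurableSet A → 0 < ν A → ∃ n : ℕ, 1 ≤ n ∧ 0 < ν (A ∩ R^[n] ⁻¹' A)

/-- `R` is ergodic with respect to `ν`: invariant sets are null or conull. -/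
def IsErgodicT {Y : Type*} [MeasurableSpace Y] (ν : Measure Y) (R : Y → Y) : Prop :=
  ∀ A : Set Y, MeasurableSet A → R ⁻¹' A = A → ν A = 0 ∨ ν Aᶜ = 0

/-- `T` is at least `ρ`-partially rigid with respect to `μ`. -/
def AtLeastPartiallyRigid {X : Type*} [MeasurableSpace X] (μ : Measure X) (T : X → X)
    (ρ : ℝ≥0∞) : Prop :=
  ∀ A : Set X, MeasurableSet A → μ A < ∞ →
    ∃ n : ℕ → ℕ, StrictMono n ∧
      ρ * μ A ≤ Filter.liminf (fun m : ℕ => μ (A ∩ T^[n m] '' A)) Filter.atTop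

/-- An integer-valued cocycle of an additive group action. -/
structure IntCocycle (G K : Type) [AddGroup G] [AddAction G K] where
  /-- the underlying function -/
  toFun : G → K → ℤ
  map_add : ∀ g h x, toFun (g + h) x = toFun g (h +ᵥ x) + toFun h x

namespace IntCocycle

section Tower

variable {G K : Type} [AddGroup G] [AddAction G K]

lemma map_zero (φ : IntCocycle G K) (x : K) : φ.toFun 0 x = 0 := by
  have h := φ.map_add 0 0 x
  simp only [add_zero, zero_vadd] at h
  omega

variable (φ : IntCocycle G K)

lemma map_neg (g : G) (x : K) : φ.toFun (-g) (g +ᵥ x) = -φ.toFun g x := by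
  have h := φ.map_add (-g) g x
  rw [neg_add_cancel, map_zero] at h
  omega

/-- The orbit equivalence relation of the skew product action on `K × ℤ`. -/
def towerSetoid : Setoid (K × ℤ) where
  r a b := ∃ g : G, b.1 = g +ᵥ a.1 ∧ b.2 = a.2 - φ.toFun g a.1
  iseqv :=
    { refl := fun a ↦ ⟨0, by simp [map_zero]⟩
      symm := by
        rintro a b ⟨g, h₁, h₂⟩
        exact ⟨-g, by rw [h₁, neg_vadd_vadd], by rw [h₂, h₁, map_neg]; ring⟩
      trans := by
        rintro a b c ⟨g, h₁, h₂⟩ ⟨h, h₃, h₄⟩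
        exact ⟨h + g, by rw [h₃, h₁, add_vadd], by rw [h₄, h₂, h₁, φ.map_add]; ring⟩ }

/-- The orbit space of the skew product action. -/
def Tower : Type := Quotient φ.towerSetoid

/-- The copy of `K` at height `n` in the orbit space. -/
def level (n : ℤ) (x : K) : φ.Tower := Quotient.mk φ.towerSetoid (x, n)

lemma level_eq_iff {n m : ℤ} {x y : K} :
    φ.level n x = φ.level m y ↔ ∃ g : G, y = g +ᵥ x ∧ m = n - φ.toFun g x :=
  Quotient.eq (r := φ.towerSetoid)

lemma level_vadd (g : G) (n : ℤ) (x : K) :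
    φ.level n (g +ᵥ x) = φ.level (n + φ.toFun g x) x :=
  (φ.level_eq_iff.2 ⟨g, rfl, by ring⟩).symm

lemma exists_level_eq (p : φ.Tower) : ∃ n x, p = φ.level n x := by
  induction p using Quotient.inductionOn with
  | h z => exact ⟨z.2, z.1, rfl⟩

lemma iUnion_range_level : ⋃ n, range (φ.level n) = univ :=
  eq_univ_of_forall fun p ↦ by
    obtain ⟨n, x, rfl⟩ := φ.exists_level_eq p
    exact mem_iUnion.2 ⟨n, x, rfl⟩

/-- Moving up by `k` levels. -/
def translate (k : ℤ) : φ.Tower → φ.Tower :=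
  Quotient.map (fun z ↦ (z.1, z.2 + k)) (by
    rintro a b ⟨g, h₁, h₂⟩
    exact ⟨g, h₁, by simp only [h₂]; ring⟩)

@[simp] lemma translate_level (k n : ℤ) (x : K) :
    φ.translate k (φ.level n x) = φ.level (n + k) x := rfl

/-- The part of the level with code `i` outside all levels with a smaller code. -/
def newLevel (i : ℕ) : Set φ.Tower :=
  disjointed (fun i ↦ range (φ.level (Denumerable.ofNat ℤ i))) i

lemma iUnion_newLevel : ⋃ i, φ.newLevel i = univ := by
  refine (iUnion_disjointed (f := fun i ↦ range (φ.level (Denumerable.ofNat ℤ i)))).trans ?_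
  rw [← φ.iUnion_range_level]
  exact (Equiv.surjective (Denumerable.eqv ℤ).symm).iUnion_comp fun n ↦ range (φ.level n)

/-- A cocycle is free when only the identity has a zero value. -/
def IsFree : Prop := ∀ g x, φ.toFun g x = 0 → g = 0

variable {φ}

lemma IsFree.level_injective (hφ : φ.IsFree) (n : ℤ) : Function.Injective (φ.level n) := by
  intro x y h
  obtain ⟨g, rfl, hg⟩ := φ.level_eq_iff.1 h
  rw [hφ g x (by omega), zero_vadd]

end Tower

section Measurable

variable {G K : Type} [AddGroup G] [AddAction G K] [MeasurableSpace K] (φ : IntCocycle G K)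

instance : MeasurableSpace φ.Tower :=
  inferInstanceAs (MeasurableSpace (Quotient φ.towerSetoid))

lemma measurable_level (n : ℤ) : Measurable (φ.level n) :=
  (measurable_quotient_mk' (s := φ.towerSetoid)).comp
    (measurable_id.prodMk measurable_const : Measurable fun x : K ↦ (x, n))

lemma measurableSet_tower_iff {B : Set φ.Tower} :
    MeasurableSet B ↔ ∀ n, MeasurableSet (φ.level n ⁻¹' B) := by
  refine ⟨fun h n ↦ φ.measurable_level n h, fun h ↦ ?_⟩
  have : (Quotient.mk φ.towerSetoid ⁻¹' B) = ⋃ n : ℤ, (φ.level n ⁻¹' B) ×ˢ {n} := by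
    ext ⟨x, n⟩
    simp only [mem_iUnion, mem_prod, mem_singleton_iff]
    exact ⟨fun h ↦ ⟨n, h, rfl⟩, fun ⟨m, h, e⟩ ↦ by subst e; exact h⟩
  refine measurableSet_quotient.2 ?_
  change MeasurableSet (Quotient.mk φ.towerSetoid ⁻¹' B)
  rw [this]
  exact MeasurableSet.iUnion fun n ↦ (h n).prod (measurableSet_singleton n)

/-- The shift of the orbit space by one level. -/
def shift : φ.Tower ≃ᵐ φ.Tower where
  toFun := φ.translate 1
  invFun := φ.translate (-1)
  left_inv p := by
    obtain ⟨n, x, rfl⟩ := φ.exists_level_eq p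
    simp
  right_inv p := by
    obtain ⟨n, x, rfl⟩ := φ.exists_level_eq p
    simp
  measurable_toFun _ hB := φ.measurableSet_tower_iff.2 fun n ↦ φ.measurable_level (n + 1) hB
  measurable_invFun _ hB := φ.measurableSet_tower_iff.2 fun n ↦ φ.measurable_level (n + -1) hB

@[simp] lemma shift_level (n : ℤ) (x : K) : φ.shift (φ.level n x) = φ.level (n + 1) x := rfl

lemma shift_iterate_level (k : ℕ) (n : ℤ) (x : K) :
    φ.shift^[k] (φ.level n x) = φ.level (n + k) x := by
  induction k with
  | zero => simp
  | succ k ih =>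
    rw [Function.iterate_succ_apply', ih, shift_level]
    congr 1
    push_cast
    ring

/-- All values of the cocycle are measurable functions. -/
def IsMeasurable : Prop := ∀ g, Measurable (φ.toFun g)

variable (ν : Measure K)

/-- The measure on the orbit space restricting to `ν` on each level. -/
noncomputable def towerMeasure : Measure φ.Tower :=
  Measure.sum fun i ↦ (ν.map (φ.level (Denumerable.ofNat ℤ i))).restrict (φ.newLevel i)

variable {φ}

variable [Countable G] [MeasurableConstVAdd G K]

lemma IsMeasurable.measurableEmbedding_level (hm : φ.IsMeasurable) (hφ : φ.IsFree) (n : ℤ) :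
    MeasurableEmbedding (φ.level n) where
  injective := hφ.level_injective n
  measurable := φ.measurable_level n
  measurableSet_image' := by
    intro A hA
    rw [measurableSet_tower_iff]
    intro m
    have : φ.level m ⁻¹' (φ.level n '' A)
        = ⋃ g : G, (fun x ↦ g +ᵥ x) ⁻¹' A ∩ φ.toFun g ⁻¹' {m - n} := by
      ext x
      simp only [mem_preimage, mem_image, mem_iUnion, mem_inter_iff, mem_singleton_iff]
      constructor
      · rintro ⟨y, hy, e⟩
        obtain ⟨g, rfl, hg⟩ := φ.level_eq_iff.1 e.symm
        exact ⟨g, hy, by omega⟩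
      · rintro ⟨g, hy, e⟩
        exact ⟨_, hy, (φ.level_eq_iff.2 ⟨g, rfl, by omega⟩).symm⟩
    rw [this]
    exact MeasurableSet.iUnion fun g ↦
      ((measurable_const_vadd g) hA).inter (hm g (measurableSet_singleton _))

/-- Two levels induce the same measure on their intersection. -/
lemma IsMeasurable.measure_preimage_level_eq [VAddInvariantMeasure G K ν]
    (hm : φ.IsMeasurable) (hφ : φ.IsFree) {n m : ℤ}
    {B : Set φ.Tower} (hB : MeasurableSet B)
    (hn : B ⊆ range (φ.level n)) (hBm : B ⊆ range (φ.level m)) :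
    ν (φ.level n ⁻¹' B) = ν (φ.level m ⁻¹' B) := by
  let A : G → Set K := fun g ↦ φ.level n ⁻¹' B ∩ φ.toFun g ⁻¹' {n - m}
  have hA : ∀ g, MeasurableSet (A g) := fun g ↦
    (φ.measurable_level n hB).inter (hm g (measurableSet_singleton _))
  have h₁ : φ.level n ⁻¹' B = ⋃ g, A g := by
    ext x
    simp only [A, mem_iUnion, mem_inter_iff, exists_and_left, iff_self_and]
    intro hx
    obtain ⟨y, hy⟩ := hBm hx
    obtain ⟨g, -, hg⟩ := φ.level_eq_iff.1 hy.symm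
    exact ⟨g, by simp [hg]⟩
  have key : ∀ g x, x ∈ A g → φ.level m (g +ᵥ x) = φ.level n x := by
    rintro g x ⟨-, hx⟩
    rw [mem_preimage, mem_singleton_iff] at hx
    rw [level_vadd, hx]
    congr 1
    ring
  have h₂ : φ.level m ⁻¹' B = ⋃ g : G, (fun x : K ↦ -g +ᵥ x) ⁻¹' A g := by
    ext y
    simp only [mem_iUnion, mem_preimage]
    constructor
    · intro hy
      obtain ⟨x, hx⟩ := hn hy
      obtain ⟨g, rfl, hg⟩ := φ.level_eq_iff.1 hx
      refine ⟨g, ?_, ?_⟩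
      · rw [neg_vadd_vadd, mem_preimage, hx]
        exact hy
      · simp [hg]
    · rintro ⟨g, hg⟩
      have := key _ _ hg
      rw [vadd_neg_vadd] at this
      rw [this]
      exact hg.1
  have d₁ : Pairwise (Function.onFun Disjoint A) := by
    intro g h hgh
    refine disjoint_left.2 fun x hx hx' ↦ hgh ?_
    have e := hφ.level_injective m ((key g x hx).trans (key h x hx').symm)
    have e' := φ.map_add (-h) g x
    have e₂ : φ.toFun (-h) (g +ᵥ x) = -φ.toFun h x := by rw [e, map_neg]
    have e₃ : φ.toFun g x = n - m := hx.2
    have e₄ : φ.toFun h x = n - m := hx'.2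
    have := hφ (-h + g) x (by omega)
    exact (neg_add_eq_zero.1 this).symm
  have d₂ : Pairwise (Function.onFun Disjoint fun g : G ↦ (fun x : K ↦ -g +ᵥ x) ⁻¹' A g) := by
    intro g h hgh
    refine disjoint_left.2 fun y hy hy' ↦ ?_
    have e := (key g _ hy).symm.trans ((congrArg (φ.level m) (by simp)).trans (key h _ hy'))
    have e' : -g +ᵥ y = -h +ᵥ y := hφ.level_injective n e
    rw [mem_preimage] at hy hy'
    rw [← e'] at hy'
    exact disjoint_left.1 (d₁ hgh) hy hy'
  rw [h₁, h₂, measure_iUnion d₁ hA, measure_iUnion d₂ fun g ↦ measurable_const_vadd (-g) (hA g)]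
  exact tsum_congr fun g ↦ (measure_preimage_vadd ν (-g) (A g)).symm

lemma IsMeasurable.measurableSet_newLevel (hm : φ.IsMeasurable) (hφ : φ.IsFree) (i : ℕ) :
    MeasurableSet (φ.newLevel i) :=
  MeasurableSet.disjointed (fun _ ↦ (hm.measurableEmbedding_level hφ _).measurableSet_range) i

lemma IsMeasurable.towerMeasure_inter_range [VAddInvariantMeasure G K ν]
    (hm : φ.IsMeasurable) (hφ : φ.IsFree) (n : ℤ) {B : Set φ.Tower} (hB : MeasurableSet B) :
    φ.towerMeasure ν (B ∩ range (φ.level n)) = ν (φ.level n ⁻¹' B) := by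
  have hr := (hm.measurableEmbedding_level hφ n).measurableSet_range
  have hN := hm.measurableSet_newLevel hφ
  rw [towerMeasure, Measure.sum_apply _ (hB.inter hr)]
  have : ∀ i, (ν.map (φ.level (Denumerable.ofNat ℤ i))).restrict (φ.newLevel i)
      (B ∩ range (φ.level n)) = ν (φ.level n ⁻¹' B ∩ φ.level n ⁻¹' φ.newLevel i) := by
    intro i
    rw [Measure.restrict_apply (hB.inter hr),
      Measure.map_apply (φ.measurable_level _) ((hB.inter hr).inter (hN i)),
      hm.measure_preimage_level_eq ν hφ ((hB.inter hr).inter (hN i)) (m := n)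
        (fun p hp ↦ disjointed_subset (fun i ↦ range (φ.level (Denumerable.ofNat ℤ i))) i hp.2)
        (fun p hp ↦ hp.1.2)]
    congr 1
    ext x
    simp
  simp_rw [this]
  rw [← measure_iUnion, ← inter_iUnion, ← preimage_iUnion, iUnion_newLevel, preimage_univ,
    inter_univ]
  · intro i j hij
    exact ((disjoint_disjointed _ hij).preimage _).mono inter_subset_right inter_subset_right
  · exact fun i ↦ φ.measurable_level n (hB.inter (hN i))

lemma IsMeasurable.restrict_towerMeasure [VAddInvariantMeasure G K ν]
    (hm : φ.IsMeasurable) (hφ : φ.IsFree) (n : ℤ) :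
    (φ.towerMeasure ν).restrict (range (φ.level n)) = ν.map (φ.level n) := by
  ext B hB
  rw [Measure.restrict_apply hB, hm.towerMeasure_inter_range ν hφ n hB,
    Measure.map_apply (φ.measurable_level n) hB]

lemma IsMeasurable.towerMeasure_image [VAddInvariantMeasure G K ν]
    (hm : φ.IsMeasurable) (hφ : φ.IsFree) (n : ℤ) {A : Set K} (hA : MeasurableSet A) :
    φ.towerMeasure ν (φ.level n '' A) = ν A := by
  have h := hm.measurableEmbedding_level hφ n
  rw [← inter_eq_left.2 (image_subset_range _ A),
    hm.towerMeasure_inter_range ν hφ n (h.measurableSet_image.2 hA),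
    preimage_image_eq _ h.injective]

lemma IsMeasurable.towerMeasure_eq_zero_iff [VAddInvariantMeasure G K ν]
    (hm : φ.IsMeasurable) (hφ : φ.IsFree) {B : Set φ.Tower} (hB : MeasurableSet B) :
    φ.towerMeasure ν B = 0 ↔ ∀ n, ν (φ.level n ⁻¹' B) = 0 := by
  simp_rw [← hm.towerMeasure_inter_range ν hφ _ hB]
  rw [← measure_iUnion_null_iff, ← inter_iUnion, φ.iUnion_range_level, inter_univ]

lemma IsMeasurable.measurePreserving_shift [VAddInvariantMeasure G K ν]
    (hm : φ.IsMeasurable) (hφ : φ.IsFree) :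
    MeasurePreserving φ.shift (φ.towerMeasure ν) (φ.towerMeasure ν) where
  measurable := φ.shift.measurable
  map_eq := by
    suffices ∀ n, (Measure.map φ.shift (φ.towerMeasure ν)).restrict (range (φ.level n))
        = (φ.towerMeasure ν).restrict (range (φ.level n)) by
      rw [← Measure.restrict_iUnion_congr, φ.iUnion_range_level] at this
      simpa using this
    intro n
    rw [hm.restrict_towerMeasure ν hφ n]
    ext B hB
    have hr := (hm.measurableEmbedding_level hφ n).measurableSet_range
    rw [Measure.restrict_apply hB,
      Measure.map_apply φ.shift.measurable (hB.inter hr),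
      Measure.map_apply (φ.measurable_level n) hB]
    have : φ.shift ⁻¹' (B ∩ range (φ.level n))
        = φ.shift ⁻¹' B ∩ range (φ.level (n - 1)) := by
      rw [preimage_inter]
      congr 1
      ext p
      obtain ⟨m, x, rfl⟩ := φ.exists_level_eq p
      simp only [mem_preimage, shift_level, mem_range, level_eq_iff]
      refine exists_congr fun y ↦ exists_congr fun g ↦ and_congr_right fun _ ↦ ?_
      omega
    rw [this, hm.towerMeasure_inter_range ν hφ _ (φ.shift.measurable hB)]
    congr 1
    ext x
    simp

lemma IsMeasurable.sigmaFinite_towerMeasure [VAddInvariantMeasure G K ν] [IsFiniteMeasure ν]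
    (hm : φ.IsMeasurable) (hφ : φ.IsFree) : SigmaFinite (φ.towerMeasure ν) := by
  refine ⟨⟨⟨fun i ↦ range (φ.level (Denumerable.ofNat ℤ i)), fun _ ↦ trivial, fun i ↦ ?_, ?_⟩⟩⟩
  · rw [← image_univ, hm.towerMeasure_image ν hφ _ MeasurableSet.univ]
    exact measure_lt_top _ _
  · rw [← φ.iUnion_range_level]
    exact (Equiv.surjective (Denumerable.eqv ℤ).symm).iUnion_comp fun n ↦ range (φ.level n)

lemma IsMeasurable.towerMeasure_singleton [VAddInvariantMeasure G K ν] [NullSingletonClass ν]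
    [MeasurableSingletonClass K] (hm : φ.IsMeasurable) (hφ : φ.IsFree) (p : φ.Tower) :
    φ.towerMeasure ν {p} = 0 := by
  obtain ⟨n, x, rfl⟩ := φ.exists_level_eq p
  rw [← image_singleton, hm.towerMeasure_image ν hφ n (measurableSet_singleton x),
    measure_singleton]

lemma IsMeasurable.towerMeasure_univ [VAddInvariantMeasure G K ν] [IsProbabilityMeasure ν]
    (hm : φ.IsMeasurable) (hφ : φ.IsFree) (a : ℕ → ℤ)
    (ha : ∀ i j, i < j → ∀ g x, φ.toFun g x ≠ a j - a i) :
    φ.towerMeasure ν univ = ∞ := by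
  refine top_le_iff.1 ?_
  have hd : Pairwise (Function.onFun Disjoint fun i ↦ range (φ.level (a i))) := by
    refine (pairwise_disjoint_on _).2 fun i j hij ↦ disjoint_left.2 ?_
    rintro _ ⟨x, rfl⟩ ⟨y, hy⟩
    obtain ⟨g, -, hg⟩ := φ.level_eq_iff.1 hy
    exact ha i j hij g y (by omega)
  calc ∞ = ∑' _ : ℕ, (1 : ℝ≥0∞) := by simp
    _ = ∑' i, φ.towerMeasure ν (range (φ.level (a i))) := tsum_congr fun i ↦ by
        rw [← image_univ, hm.towerMeasure_image ν hφ _ MeasurableSet.univ, measure_univ]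
    _ = φ.towerMeasure ν (⋃ i, range (φ.level (a i))) :=
        (measure_iUnion hd fun i ↦ (hm.measurableEmbedding_level hφ _).measurableSet_range).symm
    _ ≤ _ := measure_mono (subset_univ _)

end Measurable

end IntCocycle

/-- The alphabet of the `i`-th coordinate: three bits and an index of a family. -/
abbrev Digit (i : ℕ) : Type := ZMod 2 × ZMod 2 × ZMod 2 × ZMod (2 ^ (i + 3))

/-- The family index of a letter. -/
def Digit.fam {i : ℕ} (u : Digit i) : ZMod (2 ^ (i + 3)) := u.2.2.2

/-- The integer value of a bit. -/
def bitVal (a : ZMod 2) : ℤ := a.val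

@[simp] lemma bitVal_zero : bitVal 0 = 0 := rfl

@[simp] lemma bitVal_one : bitVal 1 = 1 := rfl

lemma bitVal_nonneg (a : ZMod 2) : 0 ≤ bitVal a := Int.natCast_nonneg _

lemma bitVal_le_one (a : ZMod 2) : bitVal a ≤ 1 := by
  have := ZMod.val_lt a
  simp only [bitVal]
  omega

lemma bitVal_injective : Function.Injective bitVal := fun _ _ h ↦
  ZMod.val_injective 2 (Int.ofNat_injective h)

/-- Expansions in base `10` with digits between `-4` and `4` are unique. -/
lemma eq_zero_of_sum_mul_ten_pow_eq_zero (n : ℕ) (a : Fin n → ℤ) (ha : ∀ m, |a m| ≤ 4)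
    (h : ∑ m, a m * 10 ^ (m : ℕ) = 0) : a = 0 := by
  induction n with
  | zero => exact Subsingleton.elim _ _
  | succ n ih =>
    rw [Fin.sum_univ_succ] at h
    have e : ∑ m : Fin n, a m.succ * 10 ^ (m.succ : ℕ)
        = 10 * ∑ m : Fin n, a m.succ * 10 ^ (m : ℕ) := by
      rw [Finset.mul_sum]
      refine Finset.sum_congr rfl fun m _ ↦ ?_
      rw [Fin.val_succ, pow_succ]
      ring
    rw [e] at h
    simp only [Fin.val_zero, pow_zero, mul_one] at h
    have h₀ := abs_le.1 (ha 0)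
    have z : a 0 = 0 := by omega
    have := ih (fun m ↦ a m.succ) (fun m ↦ ha _) (by omega)
    ext m
    refine Fin.cases z (fun m ↦ congrFun this m) m

/-- There are weights, larger than a given bound, all of whose nonzero combinations with small
coefficients are larger than the bound. -/
lemma exists_weights (ι : Type) [Fintype ι] (R : ℕ) : ∃ w : ι → ℤ, (∀ m, R < w m) ∧
    ∀ a : ι → ℤ, (∀ m, |a m| ≤ 4) → |∑ m, a m * w m| ≤ R → a = 0 := by
  let e := Fintype.equivFin ι
  refine ⟨fun m ↦ (R + 1) * 10 ^ (e m : ℕ), fun m ↦ ?_, fun a ha h ↦ ?_⟩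
  · have : (1 : ℤ) ≤ 10 ^ (e m : ℕ) := one_le_pow₀ (by norm_num)
    nlinarith
  · have h₁ : ∑ m, a m * ((R + 1) * 10 ^ (e m : ℕ)) =
        (R + 1) * ∑ m, a (e.symm m) * 10 ^ (m : ℕ) := by
      rw [Finset.mul_sum, ← e.sum_comp]
      refine Finset.sum_congr rfl fun m _ ↦ ?_
      rw [e.symm_apply_apply]
      ring
    rw [h₁] at h
    have h₂ : ∑ m, a (e.symm m) * 10 ^ (m : ℕ) = 0 := by
      by_contra hne
      have := Int.one_le_abs hne
      rw [abs_mul, abs_of_nonneg (by positivity : (0 : ℤ) ≤ R + 1)] at h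
      nlinarith
    have := eq_zero_of_sum_mul_ten_pow_eq_zero _ (fun m ↦ a (e.symm m)) (fun m ↦ ha _) h₂
    ext m
    simpa using congrFun this (e m)

/-- The index set of the weights used at stage `i`. -/
abbrev WeightIndex (i : ℕ) : Type :=
  Unit ⊕ (ZMod 2 × ZMod (2 ^ (i + 3))) ⊕ ZMod (2 ^ (i + 3))

/-- The coefficients of the weights in the height of a letter. -/
def coeff {i : ℕ} (u : Digit i) : WeightIndex i → ℤ
  | .inl _ => bitVal u.1
  | .inr (.inl x) => if x = u.2.2 then 1 else 0
  | .inr (.inr j) => if j = u.fam then bitVal u.2.1 else 0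

lemma coeff_nonneg {i : ℕ} (u : Digit i) (m : WeightIndex i) : 0 ≤ coeff u m := by
  rcases m with _ | _ | _ <;> simp only [coeff] <;> (try split_ifs) <;> simp [bitVal_nonneg]

lemma coeff_le_one {i : ℕ} (u : Digit i) (m : WeightIndex i) : coeff u m ≤ 1 := by
  rcases m with _ | _ | _ <;> simp only [coeff] <;> (try split_ifs) <;> simp [bitVal_le_one]

/-- The height of a letter for given weights and offset. -/
def height {i : ℕ} (w : WeightIndex i → ℤ) (k : ℤ) (u : Digit i) : ℤ :=
  ∑ m, coeff u m * w m - k * (bitVal u.2.1 * bitVal u.2.2.1)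

lemma height_eq {i : ℕ} (w : WeightIndex i → ℤ) (k : ℤ) (u : Digit i) :
    height w k u = bitVal u.1 * w (.inl ()) + w (.inr (.inl u.2.2))
      + bitVal u.2.1 * w (.inr (.inr u.fam)) - k * (bitVal u.2.1 * bitVal u.2.2.1) := by
  simp only [height, Fintype.sum_sum_type, coeff, ite_mul, one_mul, zero_mul,
    Finset.sum_ite_eq', Finset.mem_univ, if_true, Finset.univ_unique, Finset.sum_singleton]
  ring

lemma bitProd_mem (u : ZMod 2 × ZMod 2) :
    0 ≤ bitVal u.1 * bitVal u.2 ∧ bitVal u.1 * bitVal u.2 ≤ 1 :=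
  ⟨mul_nonneg (bitVal_nonneg _) (bitVal_nonneg _),
    mul_le_one₀ (bitVal_le_one _) (bitVal_nonneg _) (bitVal_le_one _)⟩

section Separation

variable {i : ℕ} {H : ℕ} {k : ℤ} {w : WeightIndex i → ℤ}
  (hw : ∀ a : WeightIndex i → ℤ, (∀ m, |a m| ≤ 4) →
    |∑ m, a m * w m| ≤ (4 * H + 2 * k.natAbs : ℕ) → a = 0)

include hw

lemma height_coincidence (u u' v v' : Digit i)
    (h : |(height w k u' - height w k u) - (height w k v' - height w k v)| ≤ 2 * H) :
    u.fam = v.fam ∨ (bitVal u'.1 - bitVal u.1 = bitVal v'.1 - bitVal v.1 ∧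
      height w k u' - height w k u = height w k v' - height w k v) := by
  refine or_iff_not_imp_left.2 fun hne ↦ ?_
  have hs : ∑ m, (coeff u' m - coeff u m - (coeff v' m - coeff v m)) * w m
      = (height w k u' - height w k u) - (height w k v' - height w k v)
        + k * ((bitVal u'.2.1 * bitVal u'.2.2.1 - bitVal u.2.1 * bitVal u.2.2.1)
          - (bitVal v'.2.1 * bitVal v'.2.2.1 - bitVal v.2.1 * bitVal v.2.2.1)) := by
    simp only [height, sub_mul, Finset.sum_sub_distrib]
    ring
  have hz := hw (fun m ↦ coeff u' m - coeff u m - (coeff v' m - coeff v m))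
    (fun m ↦ by
      have := coeff_nonneg u m
      have := coeff_nonneg u' m
      have := coeff_nonneg v m
      have := coeff_nonneg v' m
      have := coeff_le_one u m
      have := coeff_le_one u' m
      have := coeff_le_one v m
      have := coeff_le_one v' m
      exact abs_le.2 ⟨by omega, by omega⟩)
    (by
      rw [hs]
      refine (abs_add_le _ _).trans ?_
      rw [abs_mul]
      have : |(bitVal u'.2.1 * bitVal u'.2.2.1 - bitVal u.2.1 * bitVal u.2.2.1)
          - (bitVal v'.2.1 * bitVal v'.2.2.1 - bitVal v.2.1 * bitVal v.2.2.1)| ≤ 2 := by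
        have := bitProd_mem (u.2.1, u.2.2.1)
        have := bitProd_mem (u'.2.1, u'.2.2.1)
        have := bitProd_mem (v.2.1, v.2.2.1)
        have := bitProd_mem (v'.2.1, v'.2.2.1)
        exact abs_le.2 ⟨by linarith, by linarith⟩
      push_cast
      have := mul_le_mul_of_nonneg_left this (abs_nonneg k)
      linarith)
  have hz : ∀ m, coeff u' m - coeff u m - (coeff v' m - coeff v m) = 0 := congrFun hz
  have hne' : u.2.2 ≠ v.2.2 := fun h ↦ hne (congrArg Prod.snd h)
  have hu : u'.2.2 = u.2.2 := by
    have := hz (.inr (.inl u.2.2))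
    simp only [coeff, if_true, if_neg hne'] at this
    by_contra hc
    rw [if_neg (Ne.symm hc)] at this
    split_ifs at this <;> omega
  have hv : v'.2.2 = v.2.2 := by
    have := hz (.inr (.inl v.2.2))
    simp only [coeff, if_true, if_neg hne'.symm] at this
    by_contra hc
    rw [if_neg (Ne.symm hc)] at this
    split_ifs at this <;> omega
  have hu' : u'.fam = u.fam := congrArg Prod.snd hu
  have hv' : v'.fam = v.fam := congrArg Prod.snd hv
  have su : bitVal u'.2.1 = bitVal u.2.1 := by
    have := hz (.inr (.inr u.fam))
    simp only [coeff, if_true, hu', hv', if_neg hne] at this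
    omega
  have sv : bitVal v'.2.1 = bitVal v.2.1 := by
    have := hz (.inr (.inr v.fam))
    simp only [coeff, if_true, hu', hv', if_neg (Ne.symm hne)] at this
    omega
  refine ⟨?_, ?_⟩
  · have := hz (.inl ())
    simp only [coeff] at this
    omega
  · simp only [hz, zero_mul, Finset.sum_const_zero, hu, hv, su, sv] at hs
    linarith

lemma height_separation {u v : Digit i} (h : |height w k u - height w k v| ≤ 4 * H) : u = v := by
  have hs : ∑ m, (coeff u m - coeff v m) * w m = (height w k u - height w k v)
        + k * (bitVal u.2.1 * bitVal u.2.2.1 - bitVal v.2.1 * bitVal v.2.2.1) := by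
    simp only [height, sub_mul, Finset.sum_sub_distrib]
    ring
  have hz := hw (fun m ↦ coeff u m - coeff v m)
    (fun m ↦ by
      have := coeff_nonneg u m
      have := coeff_nonneg v m
      have := coeff_le_one u m
      have := coeff_le_one v m
      exact abs_le.2 ⟨by omega, by omega⟩)
    (by
      rw [hs]
      refine (abs_add_le _ _).trans ?_
      rw [abs_mul]
      have : |bitVal u.2.1 * bitVal u.2.2.1 - bitVal v.2.1 * bitVal v.2.2.1| ≤ 2 := by
        have := bitProd_mem (u.2.1, u.2.2.1)
        have := bitProd_mem (v.2.1, v.2.2.1)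
        exact abs_le.2 ⟨by linarith, by linarith⟩
      push_cast
      have := mul_le_mul_of_nonneg_left this (abs_nonneg k)
      linarith)
  have hz : ∀ m, coeff u m - coeff v m = 0 := congrFun hz
  have h₂ : u.2.2 = v.2.2 := by
    have := hz (.inr (.inl u.2.2))
    simp only [coeff, if_true] at this
    by_contra hc
    rw [if_neg hc] at this
    omega
  have h₁ : u.2.1 = v.2.1 := by
    have := hz (.inr (.inr u.fam))
    have hf : v.fam = u.fam := (congrArg Prod.snd h₂).symm
    simp only [coeff, if_true, hf] at this
    exact bitVal_injective (by omega)
  have h₀ : u.1 = v.1 := by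
    have := hz (.inl ())
    simp only [coeff] at this
    exact bitVal_injective (by omega)
  exact Prod.ext h₀ (Prod.ext h₁ h₂)

end Separation

/-- Heights of the letters at all stages, with the separation properties of the construction. -/
structure Cutting where
  /-- the height of a letter -/
  c : ∀ i, Digit i → ℤ
  /-- a bound for the total height variation below stage `i` -/
  H : ℕ → ℕ
  /-- the height difference of the first bit -/
  L : ℕ → ℕ
  /-- the height difference of the second bit -/
  D : ∀ i, ZMod (2 ^ (i + 3)) → ℕ
  variation_le : ∀ i u v, |c i u - c i v| + 3 * H i + 1 ≤ H (i + 1)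
  separation : ∀ i u v, |c i u - c i v| ≤ 4 * H i → u = v
  coincidence : ∀ i u u' v v', |(c i u' - c i u) - (c i v' - c i v)| ≤ 2 * H i →
    u.fam = v.fam ∨ (bitVal u'.1 - bitVal u.1 = bitVal v'.1 - bitVal v.1 ∧
      c i u' - c i u = c i v' - c i v)
  first_bit : ∀ i y, c i (1, y) - c i (0, y) = L i
  lt_L : ∀ i, H i < L i
  D_pos : ∀ i j, 0 < D i j
  second_bit_zero : ∀ i r j, c i (r, 1, 0, j) - c i (r, 0, 0, j) = D i j
  second_bit_one : ∀ i r j, c i (r, 1, 1, j) - c i (r, 0, 1, j)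
    = D i j - Denumerable.ofNat ℤ (Nat.unpair i).1

/-- Weights for stage `i` relative to a bound for the previous stages. -/
noncomputable def stageWeights (i H : ℕ) : WeightIndex i → ℤ :=
  (exists_weights (WeightIndex i)
    (4 * H + 2 * (Denumerable.ofNat ℤ (Nat.unpair i).1).natAbs)).choose

/-- Heights of the letters of stage `i` relative to a bound for the previous stages. -/
noncomputable def stageHeight (i H : ℕ) : Digit i → ℤ :=
  height (stageWeights i H) (Denumerable.ofNat ℤ (Nat.unpair i).1)

/-- Bounds for the height variation below each stage. -/
noncomputable def heightBound : ℕ → ℕ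
  | 0 => 0
  | i + 1 => 3 * heightBound i + 1 + 2 * ∑ u, (stageHeight i (heightBound i) u).natAbs

lemma stageWeights_gt (i H : ℕ) (m : WeightIndex i) : H < stageWeights i H m := by
  have := (exists_weights (WeightIndex i)
    (4 * H + 2 * (Denumerable.ofNat ℤ (Nat.unpair i).1).natAbs)).choose_spec.1 m
  rw [← stageWeights] at this
  push_cast at this
  have := abs_nonneg (Denumerable.ofNat ℤ (Nat.unpair i).1)
  omega

/-- The cutting data of the construction. -/
noncomputable def cutting : Cutting where
  c i := stageHeight i (heightBound i)
  H := heightBound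
  L i := (stageWeights i (heightBound i) (.inl ())).toNat
  D i j := (stageWeights i (heightBound i) (.inr (.inr j))).toNat
  variation_le i u v := by
    rw [heightBound]
    have h : ∀ u, (stageHeight i (heightBound i) u).natAbs
        ≤ ∑ u, (stageHeight i (heightBound i) u).natAbs := fun u ↦
      Finset.single_le_sum (f := fun u ↦ (stageHeight i (heightBound i) u).natAbs)
        (fun _ _ ↦ Nat.zero_le _) (Finset.mem_univ u)
    have := h u
    have := h v
    generalize ∑ u, (stageHeight i (heightBound i) u).natAbs = S at *
    have : |stageHeight i (heightBound i) u - stageHeight i (heightBound i) v| ≤ 2 * S :=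
      abs_le.2 ⟨by omega, by omega⟩
    push_cast
    linarith
  separation i _ _ h := height_separation (exists_weights (WeightIndex i) _).choose_spec.2 h
  coincidence i u u' v v' h :=
    height_coincidence (exists_weights (WeightIndex i) _).choose_spec.2 u u' v v' h
  first_bit i y := by
    have := stageWeights_gt i (heightBound i) (.inl ())
    rw [Int.toNat_of_nonneg (by omega), stageHeight, height_eq, height_eq]
    simp [Digit.fam]
  lt_L i := by
    have := stageWeights_gt i (heightBound i) (.inl ())
    omega
  D_pos i j := by
    have := stageWeights_gt i (heightBound i) (.inr (.inr j))
    omega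
  second_bit_zero i r j := by
    have := stageWeights_gt i (heightBound i) (.inr (.inr j))
    rw [Int.toNat_of_nonneg (by omega), stageHeight, height_eq, height_eq]
    simp [Digit.fam]
  second_bit_one i r j := by
    have := stageWeights_gt i (heightBound i) (.inr (.inr j))
    rw [Int.toNat_of_nonneg (by omega), stageHeight, height_eq, height_eq]
    simp only [Digit.fam, bitVal_zero, bitVal_one]
    ring

/-- The space of sequences of letters. -/
abbrev DigitSeq : Type := ∀ i, Digit i

/-- The group of finitely supported sequences. -/
def finSupp : AddSubgroup DigitSeq where
  carrier := {g | ∃ N, ∀ i, N ≤ i → g i = 0}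
  zero_mem' := ⟨0, fun _ _ ↦ rfl⟩
  add_mem' := by
    rintro g h ⟨N, hN⟩ ⟨M, hM⟩
    refine ⟨max N M, fun i hi ↦ ?_⟩
    rw [Pi.add_apply, hN i (le_of_max_le_left hi), hM i (le_of_max_le_right hi), add_zero]
  neg_mem' := by
    rintro g ⟨N, hN⟩
    exact ⟨N, fun i hi ↦ by rw [Pi.neg_apply, hN i hi, neg_zero]⟩

instance : Countable finSupp := by
  refine Set.countable_coe_iff.2 ?_
  have : (finSupp : Set DigitSeq) = ⋃ N, {g : DigitSeq | ∀ i, N ≤ i → g i = 0} := by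
    ext g
    simp only [mem_iUnion]
    exact Iff.rfl
  rw [this]
  refine countable_iUnion fun N ↦ Finite.countable ?_
  refine Finite.of_injOn (f := fun g (i : Fin N) ↦ g i) (t := univ) (mapsTo_univ _ _) ?_
    finite_univ
  intro g hg h hh e
  ext i : 1
  by_cases hi : i < N
  · exact congrFun e ⟨i, hi⟩
  · rw [hg i (not_lt.1 hi), hh i (not_lt.1 hi)]

/-- The finitely supported sequence with a single letter. -/
def digitAt (i : ℕ) (a : Digit i) : finSupp :=
  ⟨Pi.single i a, i + 1, fun j hj ↦ Pi.single_eq_of_ne (by omega) a⟩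

lemma digitAt_vadd_same (i : ℕ) (a : Digit i) (x : DigitSeq) : (digitAt i a +ᵥ x) i = a + x i := by
  change Pi.single i a i + x i = _
  rw [Pi.single_eq_same]

lemma digitAt_vadd_of_ne {i j : ℕ} (h : j ≠ i) (a : Digit i) (x : DigitSeq) :
    (digitAt i a +ᵥ x) j = x j := by
  change Pi.single i a j + x j = _
  rw [Pi.single_eq_of_ne h, zero_add]

namespace Cutting

variable (C : Cutting)

/-- The height difference of two sequences on the first `N` coordinates. -/
def partialDiff (N : ℕ) (x y : DigitSeq) : ℤ := ∑ i ∈ Finset.range N, (C.c i (y i) - C.c i (x i))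

lemma finsum_eq_partialDiff {N : ℕ} {x y : DigitSeq} (h : ∀ i, N ≤ i → y i = x i) :
    ∑ᶠ i, (C.c i (y i) - C.c i (x i)) = C.partialDiff N x y := by
  refine finsum_eq_sum_of_support_subset _ fun i hi ↦ ?_
  rw [Finset.coe_range, mem_Iio]
  by_contra hN
  refine hi ?_
  simp only [h i (not_lt.1 hN), sub_self]

lemma vadd_eq_of_le {g : finSupp} {N : ℕ} (hN : ∀ i, N ≤ i → (g : DigitSeq) i = 0)
    (x : DigitSeq) (i : ℕ)
    (hi : N ≤ i) : (g +ᵥ x) i = x i := by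
  change (g : DigitSeq) i + x i = x i
  rw [hN i hi, zero_add]

/-- The height difference cocycle. -/
noncomputable def cocycle : IntCocycle finSupp DigitSeq where
  toFun g x := ∑ᶠ i, (C.c i ((g +ᵥ x) i) - C.c i (x i))
  map_add g h x := by
    obtain ⟨N, hN⟩ := g.2
    obtain ⟨M, hM⟩ := h.2
    have h₁ : ∀ i, max N M ≤ i → (g +ᵥ (h +ᵥ x)) i = (h +ᵥ x) i := fun i hi ↦
      vadd_eq_of_le hN _ i (le_of_max_le_left hi)
    have h₂ : ∀ i, max N M ≤ i → (h +ᵥ x) i = x i := fun i hi ↦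
      vadd_eq_of_le hM _ i (le_of_max_le_right hi)
    rw [add_vadd, C.finsum_eq_partialDiff h₁, C.finsum_eq_partialDiff h₂,
      C.finsum_eq_partialDiff fun i hi ↦ (h₁ i hi).trans (h₂ i hi), partialDiff, partialDiff,
      partialDiff, ← Finset.sum_add_distrib]
    exact Finset.sum_congr rfl fun i _ ↦ by ring

lemma cocycle_eq_partialDiff {g : finSupp} {N : ℕ} (hN : ∀ i, N ≤ i → (g : DigitSeq) i = 0)
    (x : DigitSeq) : C.cocycle.toFun g x = C.partialDiff N x (g +ᵥ x) :=
  C.finsum_eq_partialDiff (vadd_eq_of_le hN x)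

lemma cocycle_digitAt (i : ℕ) (a : Digit i) (x : DigitSeq) :
    C.cocycle.toFun (digitAt i a) x = C.c i (a + x i) - C.c i (x i) := by
  refine (finsum_eq_single _ i fun j hj ↦ ?_).trans ?_
  · rw [digitAt_vadd_of_ne hj, sub_self]
  · rw [digitAt_vadd_same]

lemma partialDiff_succ (N : ℕ) (x y : DigitSeq) :
    C.partialDiff (N + 1) x y = C.partialDiff N x y + (C.c N (y N) - C.c N (x N)) :=
  Finset.sum_range_succ _ _

lemma three_mul_H_lt (i : ℕ) : 3 * C.H i < C.H (i + 1) := by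
  have := C.variation_le i 0 0
  simp only [sub_self, abs_zero] at this
  omega

lemma H_monotone : Monotone C.H := monotone_nat_of_le_succ fun i ↦ by
  have := C.three_mul_H_lt i
  omega

lemma abs_partialDiff_le (N : ℕ) (x y : DigitSeq) : |C.partialDiff N x y| ≤ C.H N := by
  induction N with
  | zero => simp [partialDiff]
  | succ N ih =>
    rw [partialDiff_succ]
    have := C.variation_le N (y N) (x N)
    refine (abs_add_le _ _).trans ?_
    linarith

lemma cocycle_isFree : C.cocycle.IsFree := by
  intro g x h
  obtain ⟨N, hN⟩ := g.2
  rw [C.cocycle_eq_partialDiff hN] at h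
  suffices ∀ i, (g : DigitSeq) i = 0 from Subtype.ext (funext this)
  induction N with
  | zero => exact fun i ↦ hN i (Nat.zero_le _)
  | succ N ih =>
    rw [partialDiff_succ] at h
    have hb := abs_le.1 (C.abs_partialDiff_le N x (g +ᵥ x))
    have e := C.separation N ((g +ᵥ x) N) (x N) (abs_le.2 ⟨by linarith, by linarith⟩)
    rw [e, sub_self, add_zero] at h
    refine ih h fun i hi ↦ ?_
    rcases hi.eq_or_lt with rfl | hi
    · exact add_eq_right.1 e
    · exact hN i hi

lemma partialDiff_gap (j N : ℕ) (x y : DigitSeq) :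
    |C.partialDiff N x y| ≤ C.H j ∨ 3 * C.H j < |C.partialDiff N x y| := by
  induction N with
  | zero => left; simp [partialDiff]
  | succ N ih =>
    rcases lt_or_ge N j with h | h
    · left
      exact (C.abs_partialDiff_le (N + 1) x y).trans (by exact_mod_cast C.H_monotone h)
    · rw [partialDiff_succ]
      by_cases e : y N = x N
      · rwa [e, sub_self, add_zero]
      · right
        have h₁ : 4 * (C.H N : ℤ) < |C.c N (y N) - C.c N (x N)| :=
          not_le.1 fun h ↦ e (C.separation N _ _ h)
        have h₂ := C.abs_partialDiff_le N x y
        have h₃ := abs_sub_abs_le_abs_add (C.c N (y N) - C.c N (x N)) (C.partialDiff N x y)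
        have h₄ : (C.H j : ℤ) ≤ C.H N := by exact_mod_cast C.H_monotone h
        rw [add_comm] at h₃
        linarith

lemma cocycle_ne {i j : ℕ} (hij : i < j) (g : finSupp) (x : DigitSeq) :
    C.cocycle.toFun g x ≠ 2 * C.H j - 2 * C.H i := by
  obtain ⟨N, hN⟩ := g.2
  rw [C.cocycle_eq_partialDiff hN]
  intro h
  have h₁ : 3 * C.H i < C.H j := (C.three_mul_H_lt i).trans_le (C.H_monotone hij)
  have h₂ := C.partialDiff_gap j N x (g +ᵥ x)
  rw [h, abs_of_nonneg (by omega)] at h₂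
  omega

lemma bitVal_sub_eq_of_partialDiff_eq (N : ℕ) {x x' y y' : DigitSeq}
    (h : C.partialDiff N x x' = C.partialDiff N y y')
    (hxy : ∀ i, (x i).fam ≠ (y i).fam) :
    ∀ i < N, bitVal (x' i).1 - bitVal (x i).1 = bitVal (y' i).1 - bitVal (y i).1 := by
  induction N with
  | zero => exact fun i hi ↦ absurd hi (Nat.not_lt_zero i)
  | succ N ih =>
    rw [partialDiff_succ, partialDiff_succ] at h
    have h₁ := abs_le.1 (C.abs_partialDiff_le N x x')
    have h₂ := abs_le.1 (C.abs_partialDiff_le N y y')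
    obtain ⟨h₃, h₄⟩ := (C.coincidence N (x N) (x' N) (y N) (y' N)
      (abs_le.2 ⟨by linarith, by linarith⟩)).resolve_left (hxy N)
    intro i hi
    rcases (Nat.lt_succ_iff.1 hi).eq_or_lt with rfl | hi
    · exact h₃
    · exact ih (by linarith) i hi

lemma bitVal_sub_eq_of_cocycle_eq {g h : finSupp} {x y : DigitSeq}
    (e : C.cocycle.toFun g x = C.cocycle.toFun h y) (hxy : ∀ i, (x i).fam ≠ (y i).fam) (i : ℕ) :
    bitVal ((g +ᵥ x) i).1 - bitVal (x i).1 = bitVal ((h +ᵥ y) i).1 - bitVal (y i).1 := by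
  obtain ⟨N, hN⟩ := g.2
  obtain ⟨M, hM⟩ := h.2
  have hN' : ∀ j, max (max N M) (i + 1) ≤ j → (g : DigitSeq) j = 0 := fun j hj ↦ hN j (by omega)
  have hM' : ∀ j, max (max N M) (i + 1) ≤ j → (h : DigitSeq) j = 0 := fun j hj ↦ hM j (by omega)
  rw [C.cocycle_eq_partialDiff hN', C.cocycle_eq_partialDiff hM'] at e
  exact C.bitVal_sub_eq_of_partialDiff_eq _ e hxy i (by omega)

lemma cocycle_isMeasurable : C.cocycle.IsMeasurable := by
  intro g
  obtain ⟨N, hN⟩ := g.2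
  rw [funext (C.cocycle_eq_partialDiff hN)]
  refine Finset.measurable_sum _ fun i _ ↦ Measurable.sub ?_ ?_
  · exact (measurable_of_countable (C.c i)).comp
      ((measurable_pi_apply i).comp (measurable_const_vadd g))
  · exact (measurable_of_countable (C.c i)).comp (measurable_pi_apply i)

end Cutting

instance : BorelSpace DigitSeq := Pi.borelSpace

/-- The Haar probability measure on the space of sequences. -/
noncomputable def seqMeasure : Measure DigitSeq := Measure.addHaarMeasure ⊤

instance : seqMeasure.IsAddHaarMeasure := by
  unfold seqMeasure; infer_instance

instance : IsProbabilityMeasure seqMeasure := by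
  constructor
  have := Measure.addHaarMeasure_self (K₀ := (⊤ : TopologicalSpace.PositiveCompacts DigitSeq))
  rwa [TopologicalSpace.PositiveCompacts.coe_top] at this

instance : ErgodicVAdd DigitSeq DigitSeq seqMeasure := by
  have : MeasurableAdd₂ DigitSeq := inferInstance
  infer_instance

lemma dense_finSupp : Dense (finSupp : Set DigitSeq) := by
  classical
  intro x
  refine mem_closure_of_tendsto (f := fun N i ↦ if i < N then x i else 0) (b := atTop)
    (tendsto_pi_nhds.2 fun i ↦ tendsto_const_nhds.congr' ?_) (.of_forall fun N ↦ ⟨N, fun i hi ↦ ?_⟩)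
  · filter_upwards [eventually_gt_atTop i] with N hN
    exact (if_pos hN).symm
  · exact if_neg (not_lt.2 hi)

instance : ErgodicVAdd finSupp DigitSeq seqMeasure := by
  have : AddAction.IsMinimal finSupp DigitSeq := by
    refine ⟨fun x ↦ ?_⟩
    refine ((Homeomorph.addRight x).surjective.denseRange.dense_image
      (Homeomorph.addRight x).continuous dense_finSupp).mono ?_
    rintro _ ⟨g, hg, rfl⟩
    exact ⟨⟨g, hg⟩, rfl⟩
  exact ErgodicVAdd.trans_isMinimal seqMeasure DigitSeq

instance : (nhdsWithin (0 : DigitSeq) {0}ᶜ).NeBot := by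
  rw [← mem_closure_iff_nhdsWithin_neBot]
  refine mem_closure_of_tendsto
    (f := fun N ↦ (Pi.single N ((1, 0) : Digit N) : DigitSeq)) (b := atTop)
    (tendsto_pi_nhds.2 fun i ↦ tendsto_const_nhds.congr' ?_) (.of_forall fun N h ↦ ?_)
  · filter_upwards [eventually_gt_atTop i] with N hN
    exact (Pi.single_eq_of_ne (M := Digit) hN.ne _).symm
  · have := congrFun h N
    simp at this

lemma exists_measure_inter_preimage_vadd_ne_zero {A B : Set DigitSeq} (hA : seqMeasure A ≠ 0)
    (hBm : MeasurableSet B) (hB : seqMeasure B ≠ 0) :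
    ∃ g : finSupp, seqMeasure (A ∩ (fun x ↦ g +ᵥ x) ⁻¹' B) ≠ 0 := by
  by_contra! h
  have hm : MeasurableSet (⋃ g : finSupp, (fun x ↦ g +ᵥ x) ⁻¹' B) :=
    .iUnion fun g ↦ measurable_const_vadd g hBm
  have hi (g : finSupp) : (fun x ↦ g +ᵥ x) ⁻¹' (⋃ g : finSupp, (fun x ↦ g +ᵥ x) ⁻¹' B) =
      ⋃ g : finSupp, (fun x ↦ g +ᵥ x) ⁻¹' B := by
    rw [preimage_iUnion]
    refine iUnion_congr_of_surjective (Equiv.addRight g) (Equiv.surjective _) fun h ↦ ?_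
    ext x
    simp [add_vadd]
  have hc := aeconst_of_forall_preimage_vadd_ae_eq finSupp (μ := seqMeasure)
    hm.nullMeasurableSet fun g ↦ .of_eq (hi g)
  rcases eventuallyConst_set'.1 hc with hc | hc
  · refine hB (measure_mono_null (fun x hx ↦ ?_) (ae_eq_empty.1 hc))
    exact mem_iUnion.2 ⟨0, by simpa using hx⟩
  · refine hA (measure_mono_null_ae (t := ⋃ g : finSupp, A ∩ (fun x ↦ g +ᵥ x) ⁻¹' B) ?_
      (measure_iUnion_null h))
    rw [← inter_iUnion]
    filter_upwards [hc.mem_iff] with x hx h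
    exact ⟨h, hx.2 trivial⟩

instance : NullSingletonClass seqMeasure := Measure.IsAddHaarMeasure.nullSingletonClass _

section Approximation

open scoped NNReal

variable {Ω : Type*} {Y : ℕ → Type*} [mΩ : MeasurableSpace Ω] (X : ∀ i, Ω → Y i)

/-- The measurable sets depending on finitely many of the variables `X i`. -/
def cylinderAlgebra : Set (Set Ω) :=
  {U | MeasurableSet U ∧ ∃ N, ∀ x y, (∀ i < N, X i x = X i y) → (x ∈ U ↔ y ∈ U)}

lemma isSetAlgebra_cylinderAlgebra : IsSetAlgebra (cylinderAlgebra X) where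
  empty_mem := ⟨MeasurableSet.empty, 0, fun _ _ _ ↦ Iff.rfl⟩
  compl_mem := by
    rintro U ⟨hU, N, hN⟩
    exact ⟨hU.compl, N, fun x y h ↦ not_congr (hN x y h)⟩
  union_mem := by
    rintro U V ⟨hU, N, hN⟩ ⟨hV, M, hM⟩
    refine ⟨hU.union hV, max N M, fun x y h ↦ or_congr ?_ ?_⟩
    · exact hN x y fun i hi ↦ h i (lt_max_of_lt_left hi)
    · exact hM x y fun i hi ↦ h i (lt_max_of_lt_right hi)

variable {X} [∀ i, MeasurableSpace (Y i)]

lemma generateFrom_cylinderAlgebra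
    (hX : mΩ = ⨆ i, MeasurableSpace.comap (X i) inferInstance) :
    mΩ = MeasurableSpace.generateFrom (cylinderAlgebra X) := by
  refine le_antisymm (hX.trans_le (iSup_le ?_)) (MeasurableSpace.generateFrom_le fun U hU ↦ hU.1)
  rintro i _ ⟨s, hs, rfl⟩
  have hi : MeasurableSpace.comap (X i) inferInstance ≤ mΩ :=
    (le_iSup (fun i ↦ MeasurableSpace.comap (X i) inferInstance) i).trans hX.ge
  refine MeasurableSpace.measurableSet_generateFrom ⟨hi _ ⟨s, hs, rfl⟩, i + 1, fun x y h ↦ ?_⟩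
  rw [mem_preimage, mem_preimage, h i (Nat.lt_succ_self i)]

lemma exists_cylinder_approx (hX : mΩ = ⨆ i, MeasurableSpace.comap (X i) inferInstance)
    (P : Measure Ω) [IsFiniteMeasure P] {A : Set Ω} (hA : MeasurableSet A) {ε : ℝ≥0}
    (hε : 0 < ε) :
    ∃ N, ∃ U, MeasurableSet U ∧ (∀ x y, (∀ i < N, X i x = X i y) → (x ∈ U ↔ y ∈ U)) ∧
      P (A \ U) ≤ ε ∧ P (U \ A) ≤ ε := by
  obtain ⟨U, ⟨hU, N, hN⟩, h⟩ := (Measure.MeasureDense.of_generateFrom_isSetAlgebra_finite P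
    (isSetAlgebra_cylinderAlgebra X) (generateFrom_cylinderAlgebra hX)).approx A hA
    (measure_ne_top P A) ε (by exact_mod_cast hε)
  rw [ENNReal.ofReal_coe_nnreal] at h
  exact ⟨N, U, hU, hN, (measure_mono subset_union_left).trans h.le,
    (measure_mono subset_union_right).trans h.le⟩

/-- A measurable set eventually contains many points which a modification of a single
coordinate keeps in this set, even if the value of this coordinate is constrained. -/
lemma exists_forall_measure_le_card_mul
    (hX : mΩ = ⨆ i, MeasurableSpace.comap (X i) inferInstance)
    (P : Measure Ω) [IsFiniteMeasure P] {A : Set Ω} (hA : MeasurableSet A) (D : Type*) [Fintype D]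
    {ε : ℝ≥0} (hε : 0 < ε) :
    ∃ N, ∀ i, N ≤ i → ∀ (σ : Ω → Ω) (τ : D → Ω → Ω) (E : Set Ω), MeasurableSet E →
      MeasurePreserving σ P P → (∀ δ, MeasurePreserving (τ δ) P P) →
      (∀ x, ∀ j ≠ i, X j (σ x) = X j x) → (∀ δ x, ∀ j ≠ i, X j (τ δ x) = X j x) →
      (∀ x, ∃ δ, τ δ x ∈ E) →
      P A ≤ Fintype.card D * P (A ∩ σ ⁻¹' A ∩ E) + ε := by
  set c : ℝ≥0 := 2 * Fintype.card D + 1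
  have hc : 0 < c := by positivity
  obtain ⟨N, U, hU, hN, h₁, h₂⟩ := exists_cylinder_approx hX P hA (div_pos hε hc)
  refine ⟨N, fun i hi σ τ E hE hσ hτ hσX hτX hcov ↦ ?_⟩
  have hσU (x : Ω) : σ x ∈ U ↔ x ∈ U := hN _ _ fun j hj ↦ hσX x j (by omega)
  have hτU (δ : D) (x : Ω) : τ δ x ∈ U ↔ x ∈ U := hN _ _ fun j hj ↦ hτX δ x j (by omega)
  have h₃ : P U ≤ Fintype.card D * P (U ∩ E) := by
    have : U ⊆ ⋃ δ, τ δ ⁻¹' (U ∩ E) := fun x hx ↦ by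
      obtain ⟨δ, hδ⟩ := hcov x
      exact mem_iUnion.2 ⟨δ, (hτU δ x).2 hx, hδ⟩
    refine (measure_mono this).trans ((measure_iUnion_fintype_le P _).trans_eq ?_)
    simp_rw [(hτ _).measure_preimage (hU.inter hE).nullMeasurableSet]
    simp
  have h₄ : P (U ∩ E) ≤ P (A ∩ σ ⁻¹' A ∩ E) + (P (U \ A) + P (σ ⁻¹' (U \ A))) := by
    refine (measure_mono ?_).trans ((measure_union_le _ _).trans
      (add_le_add_right (measure_union_le _ _) _))
    rintro x ⟨hx, hxE⟩
    by_cases h : x ∈ A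
    · by_cases h' : σ x ∈ A
      · exact .inl ⟨⟨h, h'⟩, hxE⟩
      · exact .inr (.inr ⟨(hσU x).2 hx, h'⟩)
    · exact .inr (.inl ⟨hx, h⟩)
  rw [hσ.measure_preimage (hU.diff hA).nullMeasurableSet] at h₄
  calc P A ≤ P U + P (A \ U) := by
        refine (measure_mono ?_).trans (measure_union_le U (A \ U))
        rw [union_sdiff_self]
        exact subset_union_right
    _ ≤ Fintype.card D * (P (A ∩ σ ⁻¹' A ∩ E) + (↑(ε / c) + ↑(ε / c))) + ↑(ε / c) := by
        gcongr
        refine h₃.trans ?_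
        gcongr
        refine h₄.trans ?_
        gcongr
    _ = Fintype.card D * P (A ∩ σ ⁻¹' A ∩ E) + ↑(c * (ε / c)) := by
        rw [mul_add, add_assoc]
        congr 1
        push_cast [c]
        ring
    _ = Fintype.card D * P (A ∩ σ ⁻¹' A ∩ E) + ε := by rw [mul_div_cancel₀ _ hc.ne']

end Approximation

lemma digitSeq_measurableSpace_eq : (inferInstance : MeasurableSpace DigitSeq) =
    ⨆ i, MeasurableSpace.comap (fun x : DigitSeq ↦ x i) inferInstance := rfl

lemma pi_digitSeq_measurableSpace_eq (ι : Type*) :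
    (inferInstance : MeasurableSpace (ι → DigitSeq)) =
    ⨆ i, MeasurableSpace.comap (fun (x : ι → DigitSeq) l ↦ x l i) inferInstance := by
  have (i : ℕ) : MeasurableSpace.comap (fun (x : ι → DigitSeq) l ↦ x l i) inferInstance =
    ⨆ l, MeasurableSpace.comap (fun x : ι → DigitSeq ↦ x l i) inferInstance := by
    refine MeasurableSpace.comap_iSup.trans ?_
    simp_rw [MeasurableSpace.comap_comp]
    rfl
  simp_rw [this]
  rw [iSup_comm]
  refine iSup_congr fun l ↦ ?_
  refine MeasurableSpace.comap_iSup.trans ?_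
  simp_rw [MeasurableSpace.comap_comp]
  rfl

lemma measure_inter_image_iterate {X : Type*} [MeasurableSpace X] {μ : Measure X} {T : X ≃ᵐ X}
    (hT : MeasurePreserving T μ μ) {A B : Set X} (hA : MeasurableSet A) (hB : MeasurableSet B)
    (n : ℕ) : μ (B ∩ T^[n] '' A) = μ (A ∩ T^[n] ⁻¹' B) := by
  have hl : Function.LeftInverse T.symm^[n] T^[n] := Function.LeftInverse.iterate T.left_inv n
  have hr : Function.RightInverse T.symm^[n] T^[n] := Function.LeftInverse.iterate T.right_inv n
  have hAn : MeasurableSet (T^[n] '' A) := by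
    rw [image_eq_preimage_of_inverse hl hr]
    exact T.symm.measurable.iterate n hA
  rw [← (hT.iterate n).measure_preimage (hB.inter hAn).nullMeasurableSet, preimage_inter,
    preimage_image_eq _ hl.injective, inter_comm]

namespace Cutting

variable (C : Cutting)

/-- The invariant measure of the constructed transformation. -/
noncomputable def measure : Measure C.cocycle.Tower := C.cocycle.towerMeasure seqMeasure

/-- The constructed transformation. -/
noncomputable def map : C.cocycle.Tower ≃ᵐ C.cocycle.Tower := C.cocycle.shift

lemma map_iterate_level (k : ℕ) (n : ℤ) (x : DigitSeq) :
    C.map^[k] (C.cocycle.level n x) = C.cocycle.level (n + k) x :=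
  C.cocycle.shift_iterate_level k n x

lemma measurePreserving_map : MeasurePreserving C.map C.measure C.measure :=
  C.cocycle_isMeasurable.measurePreserving_shift _ C.cocycle_isFree

instance : SigmaFinite C.measure :=
  C.cocycle_isMeasurable.sigmaFinite_towerMeasure _ C.cocycle_isFree

lemma measure_singleton (p : C.cocycle.Tower) : C.measure {p} = 0 :=
  C.cocycle_isMeasurable.towerMeasure_singleton _ C.cocycle_isFree p

lemma measure_univ : C.measure univ = ∞ :=
  C.cocycle_isMeasurable.towerMeasure_univ _ C.cocycle_isFree (fun i ↦ 2 * C.H i)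
    fun _ _ h ↦ C.cocycle_ne h

lemma measurableEmbedding_level (n : ℤ) : MeasurableEmbedding (C.cocycle.level n) :=
  C.cocycle_isMeasurable.measurableEmbedding_level C.cocycle_isFree n

lemma restrict_measure (n : ℤ) :
    C.measure.restrict (range (C.cocycle.level n)) = seqMeasure.map (C.cocycle.level n) :=
  C.cocycle_isMeasurable.restrict_towerMeasure _ C.cocycle_isFree n

lemma measure_inter_range (n : ℤ) {B : Set C.cocycle.Tower} (hB : MeasurableSet B) :
    C.measure (B ∩ range (C.cocycle.level n)) = seqMeasure (C.cocycle.level n ⁻¹' B) :=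
  C.cocycle_isMeasurable.towerMeasure_inter_range _ C.cocycle_isFree n hB

lemma seqMeasure_preimage_level_le (n : ℤ) {B : Set C.cocycle.Tower} (hB : MeasurableSet B) :
    seqMeasure (C.cocycle.level n ⁻¹' B) ≤ C.measure B :=
  (C.measure_inter_range n hB).symm.trans_le (measure_mono inter_subset_left)

lemma exists_seqMeasure_preimage_level_ne_zero {B : Set C.cocycle.Tower} (hB : MeasurableSet B)
    (h : C.measure B ≠ 0) : ∃ n, seqMeasure (C.cocycle.level n ⁻¹' B) ≠ 0 := by
  by_contra! h'
  exact h ((C.cocycle_isMeasurable.towerMeasure_eq_zero_iff _ C.cocycle_isFree hB).2 h')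

lemma level_digitAt_vadd (i : ℕ) (a : Digit i) (n : ℤ) (x : DigitSeq) :
    C.cocycle.level n (digitAt i a +ᵥ x) =
      C.cocycle.level (n + (C.c i (a + x i) - C.c i (x i))) x := by
  rw [C.cocycle.level_vadd, C.cocycle_digitAt]

lemma level_digitAt_first_vadd {i : ℕ} {x : DigitSeq} (h : (x i).1 = 0) (n : ℤ) :
    C.cocycle.level n (digitAt i (1, 0) +ᵥ x) = C.map^[C.L i] (C.cocycle.level n x) := by
  rw [map_iterate_level, level_digitAt_vadd, ← C.first_bit i (x i).2]
  congr 4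
  · ext <;> simp [h]
  · rw [← h]

lemma level_digitAt_second_vadd_zero {i : ℕ} {x : DigitSeq} (hs : (x i).2.1 = 0)
    (ht : (x i).2.2.1 = 0) (n : ℤ) :
    C.cocycle.level n (digitAt i (0, 1, 0) +ᵥ x) =
      C.cocycle.level (n + C.D i (x i).fam) x := by
  rw [level_digitAt_vadd, ← C.second_bit_zero i (x i).1]
  congr 4
  · ext <;> simp [hs, ht, Digit.fam]
  · ext <;> simp [hs, ht, Digit.fam]

lemma level_digitAt_second_vadd_one {i : ℕ} {x : DigitSeq} (hs : (x i).2.1 = 0)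
    (ht : (x i).2.2.1 = 1) (n : ℤ) :
    C.cocycle.level n (digitAt i (0, 1, 0) +ᵥ x) =
      C.cocycle.level (n + (C.D i (x i).fam - Denumerable.ofNat ℤ (Nat.unpair i).1)) x := by
  rw [level_digitAt_vadd, ← C.second_bit_one i (x i).1]
  congr 4
  · ext <;> simp [hs, ht, Digit.fam]
  · ext <;> simp [hs, ht, Digit.fam]

lemma strictMono_L : StrictMono C.L := by
  refine strictMono_nat_of_lt_succ fun i ↦ lt_of_le_of_lt ?_ (C.lt_L (i + 1))
  have h₁ := C.variation_le i (1, 0) (0, 0)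
  have h₂ := C.first_bit i 0
  have h₃ := le_abs_self (C.c i (1, 0) - C.c i (0, 0))
  omega

lemma L_pos (i : ℕ) : 0 < C.L i := (Nat.zero_le _).trans_lt (C.lt_L i)

end Cutting

lemma measurePreserving_digitAt_vadd (i : ℕ) (a : Digit i) :
    MeasurePreserving (fun x : DigitSeq ↦ digitAt i a +ᵥ x) seqMeasure seqMeasure :=
  measurePreserving_vadd _ _

lemma measurableSet_digit (i : ℕ) (S : Set (Digit i)) :
    MeasurableSet {x : DigitSeq | x i ∈ S} :=
  measurable_pi_apply i (Set.Countable.measurableSet S.to_countable)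

namespace Cutting

variable (C : Cutting)

lemma measure_le_two_mul_liminf (n : ℤ) {A : Set C.cocycle.Tower} (hA : MeasurableSet A) :
    seqMeasure (C.cocycle.level n ⁻¹' A) ≤ 2 * liminf (fun i ↦ C.measure
      ((A ∩ C.map^[C.L i] ⁻¹' A) ∩ range (C.cocycle.level n))) atTop := by
  refine ENNReal.le_of_forall_pos_le_add fun ε hε _ ↦ ?_
  obtain ⟨N, hN⟩ := exists_forall_measure_le_card_mul digitSeq_measurableSpace_eq seqMeasure
    (C.cocycle.measurable_level n hA) (ZMod 2) hε
  have key : ∀ i, N ≤ i → (seqMeasure (C.cocycle.level n ⁻¹' A) - ε) / 2 ≤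
      C.measure ((A ∩ C.map^[C.L i] ⁻¹' A) ∩ range (C.cocycle.level n)) := by
    intro i hi
    have h := hN i hi (fun x ↦ digitAt i (1, 0) +ᵥ x) (fun δ x ↦ digitAt i (δ, 0) +ᵥ x)
      {x | x i ∈ {u : Digit i | u.1 = 0}} (measurableSet_digit i _)
      (measurePreserving_digitAt_vadd i _) (fun _ ↦ measurePreserving_digitAt_vadd i _)
      (fun x j hj ↦ digitAt_vadd_of_ne hj _ x) (fun _ x j hj ↦ digitAt_vadd_of_ne hj _ x)
      (fun x ↦ ⟨-(x i).1, by
        rw [mem_ofPred_eq, digitAt_vadd_same]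
        exact neg_add_cancel _⟩)
    rw [ZMod.card] at h
    rw [C.measure_inter_range n (hA.inter (C.map.measurable.iterate _ hA))]
    refine ENNReal.div_le_of_le_mul ?_
    rw [tsub_le_iff_right, mul_comm]
    refine h.trans ?_
    push_cast
    gcongr
    rintro x ⟨⟨h₁, h₂⟩, h₃⟩
    refine ⟨h₁, ?_⟩
    rw [mem_preimage, ← C.level_digitAt_first_vadd h₃]
    exact h₂
  have h := le_liminf_of_le (by isBoundedDefault) (eventually_atTop.2 ⟨N, key⟩)
  rw [← tsub_le_iff_right, mul_comm]
  exact (ENNReal.div_le_iff (by norm_num) (by norm_num)).1 h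

theorem map_partiallyRigid : AtLeastPartiallyRigid C.measure C.map (1 / 2) := by
  intro A hA _
  refine ⟨C.L, C.strictMono_L, ?_⟩
  simp_rw [measure_inter_image_iterate C.measurePreserving_map hA hA]
  have hm (k : ℕ) : MeasurableSet (C.cocycle.newLevel k) :=
    C.cocycle_isMeasurable.measurableSet_newLevel C.cocycle_isFree k
  have hd : Pairwise (Function.onFun Disjoint C.cocycle.newLevel) := disjoint_disjointed _
  set n : ℕ → ℤ := Denumerable.ofNat ℤ
  have hn (k : ℕ) : C.cocycle.newLevel k ⊆ range (C.cocycle.level (n k)) := disjointed_subset _ k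
  set B : ℕ → Set C.cocycle.Tower := fun k ↦ A ∩ C.cocycle.newLevel k
  have hB (k : ℕ) : MeasurableSet (B k) := hA.inter (hm k)
  have hBd : Pairwise (Function.onFun Disjoint B) := fun i j h ↦
    (hd h).mono inter_subset_right inter_subset_right
  set f : ℕ → ℕ → ℝ≥0∞ := fun i k ↦
    C.measure ((B k ∩ C.map^[C.L i] ⁻¹' B k) ∩ range (C.cocycle.level (n k)))
  have h₁ (k : ℕ) : C.measure (B k) ≤ 2 * liminf (fun i ↦ f i k) atTop := by
    refine Eq.trans_le ?_ (C.measure_le_two_mul_liminf (n k) (hB k))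
    rw [← C.measure_inter_range _ (hB k),
      inter_eq_left.2 (inter_subset_right.trans (hn k))]
  have h₂ : C.measure A = ∑' k, C.measure (B k) := by
    rw [← measure_iUnion hBd hB, ← inter_iUnion, C.cocycle.iUnion_newLevel, inter_univ]
  have h₃ (i : ℕ) : ∑' k, f i k ≤ C.measure (A ∩ C.map^[C.L i] ⁻¹' A) := by
    rw [← measure_iUnion (fun j k h ↦ (hBd h).mono (fun x hx ↦ hx.1.1) fun x hx ↦ hx.1.1)
      fun k ↦ ((hB k).inter (C.map.measurable.iterate _ (hB k))).inter
        (C.measurableEmbedding_level _).measurableSet_range]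
    exact measure_mono (iUnion_subset fun k x hx ↦ ⟨hx.1.1.1, hx.1.2.1⟩)
  have h₄ : ∑' k, liminf (fun i ↦ f i k) atTop ≤ liminf (fun i ↦ ∑' k, f i k) atTop := by
    simp_rw [← lintegral_count]
    exact lintegral_liminf_le fun i ↦ measurable_of_countable _
  calc 1 / 2 * C.measure A ≤ 1 / 2 * (2 * ∑' k, liminf (fun i ↦ f i k) atTop) := by
        rw [h₂, ← ENNReal.tsum_mul_left (a := 2)]
        exact mul_le_mul' le_rfl (ENNReal.tsum_le_tsum h₁)
    _ = ∑' k, liminf (fun i ↦ f i k) atTop := by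
        rw [← mul_assoc, one_div, ENNReal.inv_mul_cancel (by norm_num) (by norm_num), one_mul]
    _ ≤ _ := h₄.trans (liminf_le_liminf (.of_forall h₃))

end Cutting

namespace Cutting

variable (C : Cutting)

/-- Two copies of a set of positive measure, at two levels of the tower, are hit at the same
time by a single one of them. -/
lemma exists_iterate_level_mem {S : Set DigitSeq} (hS : MeasurableSet S) (h : seqMeasure S ≠ 0)
    (k : ℤ) : ∃ n : ℕ, 1 ≤ n ∧
      seqMeasure {x ∈ S | ∃ y ∈ S, ∀ m, C.cocycle.level (m + n) x = C.cocycle.level m y} ≠ 0 ∧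
      seqMeasure {x ∈ S | ∃ y ∈ S, ∀ m, C.cocycle.level (m + n) x =
        C.cocycle.level (m + k) y} ≠ 0 := by
  obtain ⟨ε, hε, hεS⟩ := ENNReal.lt_iff_exists_nnreal_btwn.1 (pos_iff_ne_zero.2 h)
  obtain ⟨N, hN⟩ := exists_forall_measure_le_card_mul digitSeq_measurableSpace_eq seqMeasure
    hS (ZMod 2 × ZMod 2) (ENNReal.coe_pos.1 hε)
  set i := Nat.pair (Encodable.encode k) N
  have hk : Denumerable.ofNat ℤ (Nat.unpair i).1 = k := by
    rw [Nat.unpair_pair, Denumerable.ofNat_encode]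
  set σ : DigitSeq → DigitSeq := fun x ↦ digitAt i (0, 1, 0) +ᵥ x
  set F : ZMod (2 ^ (i + 3)) → ZMod 2 → Set DigitSeq := fun j t ↦
    {x | (x i).2.1 = 0 ∧ (x i).2.2.1 = t ∧ (x i).fam = j}
  obtain ⟨j, hj⟩ : ∃ j, ∀ t, seqMeasure (S ∩ σ ⁻¹' S ∩ F j t) ≠ 0 := by
    by_contra! hnull
    choose t ht using hnull
    have := hN i (Nat.right_le_pair _ _) σ (fun δ x ↦ digitAt i (0, δ.1, δ.2, 0) +ᵥ x)
      {x | x i ∈ {u : Digit i | u.2.1 = 0 ∧ u.2.2.1 = t u.fam}} (measurableSet_digit i _)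
      (measurePreserving_digitAt_vadd i _) (fun _ ↦ measurePreserving_digitAt_vadd i _)
      (fun x j hj ↦ digitAt_vadd_of_ne hj _ x) (fun _ x j hj ↦ digitAt_vadd_of_ne hj _ x)
      (fun x ↦ ⟨(-(x i).2.1, t (x i).fam - (x i).2.2.1), by
        rw [mem_ofPred_eq, digitAt_vadd_same]
        refine ⟨neg_add_cancel _, ?_⟩
        have : ((0, -(x i).2.1, t (x i).fam - (x i).2.2.1, 0) + x i : Digit i).fam = (x i).fam :=
          zero_add _
        rw [this]
        exact sub_add_cancel _ _⟩)
    refine hεS.not_ge (this.trans ?_)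
    rw [measure_mono_null (t := ⋃ j, S ∩ σ ⁻¹' S ∩ F j (t j)) ?_ (measure_iUnion_null ht),
      mul_zero, zero_add]
    exact fun x hx ↦ mem_iUnion.2 ⟨(x i).fam, hx.1, hx.2.1, hx.2.2, rfl⟩
  refine ⟨C.D i j, C.D_pos i j, fun h₀ ↦ hj 0 (measure_mono_null ?_ h₀),
    fun h₀ ↦ hj 1 (measure_mono_null ?_ h₀)⟩
  · rintro x ⟨⟨hx, hσx⟩, hs, ht, rfl⟩
    exact ⟨hx, σ x, hσx, fun m ↦ (C.level_digitAt_second_vadd_zero hs ht m).symm⟩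
  · rintro x ⟨⟨hx, hσx⟩, hs, ht, rfl⟩
    refine ⟨hx, σ x, hσx, fun m ↦ ?_⟩
    rw [C.level_digitAt_second_vadd_one hs ht, hk]
    congr 1
    ring

theorem map_wde : WDE C.measure C.map := by
  intro A B hA hB hA₀ hB₀
  obtain ⟨a, ha⟩ := C.exists_seqMeasure_preimage_level_ne_zero hA hA₀.ne'
  obtain ⟨b, hb⟩ := C.exists_seqMeasure_preimage_level_ne_zero hB hB₀.ne'
  obtain ⟨g, hg⟩ := exists_measure_inter_preimage_vadd_ne_zero ha
    (C.cocycle.measurable_level b hB) hb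
  set S := C.cocycle.level a ⁻¹' A ∩ (fun x ↦ g +ᵥ x) ⁻¹' (C.cocycle.level b ⁻¹' B)
  have hS : MeasurableSet S := (C.cocycle.measurable_level a hA).inter
    (measurable_const_vadd g (C.cocycle.measurable_level b hB))
  obtain ⟨v, hv⟩ : ∃ v, seqMeasure (S ∩ C.cocycle.toFun g ⁻¹' {v}) ≠ 0 := by
    by_contra! h
    refine hg (measure_mono_null (fun x hx ↦ ?_) (measure_iUnion_null h))
    exact mem_iUnion.2 ⟨C.cocycle.toFun g x, hx, rfl⟩
  set S' := S ∩ C.cocycle.toFun g ⁻¹' {v}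
  have hS' : MeasurableSet S' := hS.inter (C.cocycle_isMeasurable g (measurableSet_singleton v))
  have hA' : ∀ x ∈ S', C.cocycle.level a x ∈ A := fun x hx ↦ hx.1.1
  have hB' : ∀ x ∈ S', C.cocycle.level (a + (b + v - a)) x ∈ B := by
    rintro x ⟨⟨-, hx⟩, rfl⟩
    rw [mem_preimage, mem_preimage, C.cocycle.level_vadd] at hx
    convert hx using 2
    ring
  obtain ⟨n, hn, h₁, h₂⟩ := C.exists_iterate_level_mem hS' hv (b + v - a)
  refine ⟨n, hn, ?_, ?_⟩
  · rw [measure_inter_image_iterate C.measurePreserving_map hA hA]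
    refine (pos_iff_ne_zero.2 h₁).trans_le ((measure_mono ?_).trans
      (C.seqMeasure_preimage_level_le a (hA.inter (C.map.measurable.iterate n hA))))
    rintro x ⟨hx, y, hy, h⟩
    refine ⟨hA' x hx, ?_⟩
    rw [mem_preimage, map_iterate_level, h]
    exact hA' y hy
  · rw [measure_inter_image_iterate C.measurePreserving_map hA hB]
    refine (pos_iff_ne_zero.2 h₂).trans_le ((measure_mono ?_).trans
      (C.seqMeasure_preimage_level_le a (hA.inter (C.map.measurable.iterate n hB))))
    rintro x ⟨hx, y, hy, h⟩
    refine ⟨hA' x hx, ?_⟩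
    rw [mem_preimage, map_iterate_level, h]
    exact hB' y hy

section Pi

variable {ι : Type*}

lemma measurable_pi_level (n : ι → ℤ) :
    Measurable fun (x : ι → DigitSeq) l ↦ C.cocycle.level (n l) (x l) :=
  measurable_pi_lambda _ fun l ↦ (C.cocycle.measurable_level _).comp (measurable_pi_apply l)

variable [Fintype ι]

lemma restrict_pi_measure (n : ι → ℤ) :
    (Measure.pi fun _ : ι ↦ C.measure).restrict
      (univ.pi fun l ↦ range (C.cocycle.level (n l))) =
    (Measure.pi fun _ : ι ↦ seqMeasure).map fun x l ↦ C.cocycle.level (n l) (x l) := by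
  rw [Measure.restrict_pi_pi]
  simp_rw [restrict_measure]
  have (l : ι) : IsProbabilityMeasure (seqMeasure.map (C.cocycle.level (n l))) :=
    Measure.isProbabilityMeasure_map (C.cocycle.measurable_level _).aemeasurable
  exact (Measure.pi_map_pi fun l ↦ (C.cocycle.measurable_level _).aemeasurable).symm

lemma pi_measure_inter (n : ι → ℤ) {B : Set (ι → C.cocycle.Tower)} (hB : MeasurableSet B) :
    (Measure.pi fun _ : ι ↦ C.measure) (B ∩ univ.pi fun l ↦ range (C.cocycle.level (n l))) =
    (Measure.pi fun _ : ι ↦ seqMeasure) {x | (fun l ↦ C.cocycle.level (n l) (x l)) ∈ B} := by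
  rw [← Measure.restrict_apply hB, restrict_pi_measure,
    Measure.map_apply (C.measurable_pi_level n) hB]
  rfl

theorem pi_map_isConservative :
    IsConservative (Measure.pi fun _ : ι ↦ C.measure) (fun x l ↦ C.map (x l)) := by
  classical
  intro A hA hA₀
  obtain ⟨n, hn⟩ : ∃ n : ι → ℤ, (Measure.pi fun _ : ι ↦ C.measure)
      (A ∩ univ.pi fun l ↦ range (C.cocycle.level (n l))) ≠ 0 := by
    by_contra! h
    refine hA₀.ne' (measure_mono_null (fun p hp ↦ ?_) (measure_iUnion_null h))
    choose n x hx using fun l ↦ C.cocycle.exists_level_eq (p l)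
    exact mem_iUnion.2 ⟨n, hp, fun l _ ↦ ⟨x l, (hx l).symm⟩⟩
  rw [C.pi_measure_inter n hA] at hn
  obtain ⟨ε, hε, hεA⟩ := ENNReal.lt_iff_exists_nnreal_btwn.1 (pos_iff_ne_zero.2 hn)
  obtain ⟨N, hN⟩ := exists_forall_measure_le_card_mul (pi_digitSeq_measurableSpace_eq ι)
    (Measure.pi fun _ : ι ↦ seqMeasure) (C.measurable_pi_level n hA) (ι → ZMod 2)
    (ENNReal.coe_pos.1 hε)
  have hp (a : ι → Digit N) : MeasurePreserving
      (fun (x : ι → DigitSeq) l ↦ digitAt N (a l) +ᵥ x l)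
      (Measure.pi fun _ : ι ↦ seqMeasure) (Measure.pi fun _ : ι ↦ seqMeasure) :=
    measurePreserving_pi _ _ fun l ↦ measurePreserving_digitAt_vadd N (a l)
  have h := hN N le_rfl (fun x l ↦ digitAt N (1, 0) +ᵥ x l)
    (fun δ x l ↦ digitAt N (δ l, 0) +ᵥ x l)
    {x | ∀ l, x l ∈ {y : DigitSeq | y N ∈ {u : Digit N | u.1 = 0}}}
    (by
      simp_rw [ofPred_forall]
      exact .iInter fun l ↦ measurable_pi_apply l (measurableSet_digit N _))
    (hp _) (fun δ ↦ hp _)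
    (fun x j hj ↦ funext fun l ↦ digitAt_vadd_of_ne hj _ (x l))
    (fun _ x j hj ↦ funext fun l ↦ digitAt_vadd_of_ne hj _ (x l))
    (fun x ↦ ⟨fun l ↦ -(x l N).1, fun l ↦ by
      change ((digitAt N (-(x l N).1, 0) +ᵥ x l) N).1 = 0
      rw [digitAt_vadd_same]
      exact neg_add_cancel _⟩)
  refine ⟨C.L N, C.L_pos N, pos_iff_ne_zero.2 fun h₀ ↦ hεA.not_ge (h.trans ?_)⟩
  have hR : Measurable fun (x : ι → C.cocycle.Tower) l ↦ C.map (x l) :=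
    measurable_pi_lambda _ fun l ↦ C.map.measurable.comp (measurable_pi_apply l)
  have h₁ := C.pi_measure_inter n (hA.inter (hR.iterate (C.L N) hA))
  rw [measure_mono_null inter_subset_left h₀] at h₁
  rw [measure_mono_null (fun x hx ↦ ?_) h₁.symm, mul_zero, zero_add]
  obtain ⟨⟨hx₁, hx₂⟩, hx₃⟩ := hx
  refine ⟨hx₁, ?_⟩
  change (Pi.map fun _ ↦ C.map)^[C.L N] _ ∈ A
  rw [Pi.map_iterate]
  have e : (Pi.map (fun _ ↦ C.map^[C.L N]) fun l ↦ C.cocycle.level (n l) (x l)) =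
      fun l ↦ C.cocycle.level (n l) (digitAt N (1, 0) +ᵥ x l) :=
    funext fun l ↦ (C.level_digitAt_first_vadd (hx₃ l) (n l)).symm
  rw [e]
  exact hx₂

end Pi

end Cutting

lemma card_mul_prod_seqMeasure_sub_eq {i : ℕ} {Z : Type} [AddCommGroup Z] [Fintype Z]
    (f : Digit i →+ Z) (hf : Function.Surjective f) (z : Z) :
    Fintype.card Z * (seqMeasure.prod seqMeasure) {p | f (p.2 i) - f (p.1 i) = z} = 1 := by
  have hm (z : Z) : MeasurableSet {p : DigitSeq × DigitSeq | f (p.2 i) - f (p.1 i) = z} :=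
    (((measurable_pi_apply i).comp measurable_fst).prodMk
      ((measurable_pi_apply i).comp measurable_snd))
      (Set.Countable.measurableSet (s := {q : Digit i × Digit i | f q.2 - f q.1 = z})
        (Set.to_countable _))
  have he (w : Z) : (seqMeasure.prod seqMeasure) {p | f (p.2 i) - f (p.1 i) = w} =
      (seqMeasure.prod seqMeasure) {p | f (p.2 i) - f (p.1 i) = z} := by
    obtain ⟨a, ha⟩ := hf (z - w)
    rw [← ((MeasurePreserving.id seqMeasure).prod
      (measurePreserving_digitAt_vadd i a)).measure_preimage (hm z).nullMeasurableSet]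
    congr 1
    ext ⟨x, y⟩
    change _ ↔ f ((digitAt i a +ᵥ y) i) - f (x i) = z
    rw [digitAt_vadd_same, map_add, ha, add_sub_assoc, sub_add_eq_add_sub, sub_eq_iff_eq_add,
      add_right_inj]
    rfl
  rw [← nsmul_eq_mul, ← Finset.card_univ, ← Finset.sum_const, ← Finset.sum_congr rfl fun w _ ↦ he w,
    ← tsum_fintype (L := .unconditional Z), ← measure_iUnion _ hm,
    ← measure_univ (μ := seqMeasure.prod seqMeasure)]
  · congr 1
    exact eq_univ_of_forall fun p ↦ mem_iUnion.2 ⟨_, rfl⟩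
  · exact fun a b hab ↦ disjoint_left.2 fun p hp hp' ↦ hab (hp.symm.trans hp')

lemma prod_seqMeasure_exists_fam_eq_lt :
    (seqMeasure.prod seqMeasure) {p | ∃ i, (p.1 i).fam = (p.2 i).fam} < 2⁻¹ := by
  have h (i : ℕ) : (seqMeasure.prod seqMeasure) {p | (p.1 i).fam = (p.2 i).fam} =
      2⁻¹ ^ (i + 3) := by
    have := card_mul_prod_seqMeasure_sub_eq (i := i) ((AddMonoidHom.snd _ _).comp
      ((AddMonoidHom.snd _ _).comp (AddMonoidHom.snd _ _)))
      (fun j ↦ ⟨(0, 0, 0, j), rfl⟩) 0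
    rw [ZMod.card, mul_comm] at this
    rw [← ENNReal.inv_pow, ← ENNReal.eq_inv_of_mul_eq_one_left (b := 2 ^ (i + 3))
      (by exact_mod_cast this)]
    congr 1
    ext p
    exact eq_comm.trans sub_eq_zero.symm
  calc _ ≤ ∑' i, (seqMeasure.prod seqMeasure) {p | (p.1 i).fam = (p.2 i).fam} := by
        rw [ofPred_exists]
        exact measure_iUnion_le _
    _ = 2⁻¹ ^ 2 := by
        rw [tsum_congr fun i ↦ (h i).trans (pow_add _ i 3), ENNReal.tsum_mul_right,
          ENNReal.tsum_geometric, ENNReal.one_sub_inv_two, inv_inv, pow_succ', ← mul_assoc,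
          ENNReal.mul_inv_cancel two_ne_zero ENNReal.ofNat_ne_top, one_mul]
    _ < 2⁻¹ := by
        rw [← ENNReal.inv_pow, ENNReal.inv_lt_inv]
        norm_num

lemma prod_seqMeasure_fam_ne_inter_ne_zero (z : ZMod 2) :
    (seqMeasure.prod seqMeasure)
      {p | (∀ i, (p.1 i).fam ≠ (p.2 i).fam) ∧ (p.2 0).1 - (p.1 0).1 = z} ≠ 0 := by
  intro h₀
  have := card_mul_prod_seqMeasure_sub_eq (i := 0) (AddMonoidHom.fst _ _)
    (fun a ↦ ⟨(a, 0), rfl⟩) z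
  rw [ZMod.card, mul_comm] at this
  refine prod_seqMeasure_exists_fam_eq_lt.not_ge ?_
  rw [← ENNReal.eq_inv_of_mul_eq_one_left (b := 2) this]
  refine (measure_mono fun p hp ↦ ?_).trans ((measure_union_le _ _).trans_eq
    (congrArg₂ (· + ·) h₀ rfl)) |>.trans_eq (zero_add _)
  by_cases h : ∃ i, (p.1 i).fam = (p.2 i).fam
  · exact .inr h
  · exact .inl ⟨not_exists.1 h, hp⟩

namespace Cutting

variable (C : Cutting)

lemma restrict_prod_measure (n m : ℤ) :
    (C.measure.prod C.measure).restrict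
      (range (C.cocycle.level n) ×ˢ range (C.cocycle.level m)) =
    (seqMeasure.prod seqMeasure).map (Prod.map (C.cocycle.level n) (C.cocycle.level m)) := by
  rw [← Measure.prod_restrict, restrict_measure, restrict_measure]
  exact Measure.map_prod_map _ _ (C.cocycle.measurable_level n) (C.cocycle.measurable_level m)

lemma prod_seqMeasure_preimage_level_le (n m : ℤ) {B : Set (C.cocycle.Tower × C.cocycle.Tower)}
    (hB : MeasurableSet B) :
    (seqMeasure.prod seqMeasure) (Prod.map (C.cocycle.level n) (C.cocycle.level m) ⁻¹' B) ≤
      (C.measure.prod C.measure) B := by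
  rw [← Measure.map_apply ((C.cocycle.measurable_level n).prodMap (C.cocycle.measurable_level m))
    hB, ← restrict_prod_measure]
  exact Measure.restrict_apply_le _ _

lemma eq_of_level_eq {n m : ℤ} {x y x' y' : DigitSeq} (hxy : ∀ i, (x i).fam ≠ (y i).fam)
    (hx : C.cocycle.level n x = C.cocycle.level m x')
    (hy : C.cocycle.level n y = C.cocycle.level m y') (i : ℕ) :
    (x i).1 = (y i).1 ↔ (x' i).1 = (y' i).1 := by
  obtain ⟨g, rfl, hg⟩ := C.cocycle.level_eq_iff.1 hx
  obtain ⟨h, rfl, hh⟩ := C.cocycle.level_eq_iff.1 hy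
  have := C.bitVal_sub_eq_of_cocycle_eq (g := g) (h := h) (by omega) hxy i
  rw [← bitVal_injective.eq_iff, ← bitVal_injective.eq_iff]
  omega

theorem map_prod_not_isErgodicT :
    ¬ IsErgodicT (C.measure.prod C.measure) (Prod.map C.map C.map) := by
  intro h
  set W : ZMod 2 → Set (DigitSeq × DigitSeq) := fun z ↦
    {p | (∀ i, (p.1 i).fam ≠ (p.2 i).fam) ∧ (p.2 0).1 - (p.1 0).1 = z}
  have hd (i : ℕ) (S : Set (Digit i × Digit i)) :
      MeasurableSet {p : DigitSeq × DigitSeq | (p.1 i, p.2 i) ∈ S} :=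
    (((measurable_pi_apply i).comp measurable_fst).prodMk
      ((measurable_pi_apply i).comp measurable_snd)) (Set.Countable.measurableSet S.to_countable)
  have hW : MeasurableSet (W 0) := by
    simp only [W, ofPred_and, ofPred_forall]
    exact (MeasurableSet.iInter fun i ↦ hd i {q | q.1.fam ≠ q.2.fam}).inter
      (hd 0 {q | q.2.1 - q.1.1 = 0})
  let ℓ : ℤ → DigitSeq × DigitSeq → C.cocycle.Tower × C.cocycle.Tower := fun n ↦
    Prod.map (C.cocycle.level n) (C.cocycle.level n)
  have hA : MeasurableSet (⋃ n, ℓ n '' W 0) := .iUnion fun n ↦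
    ((C.measurableEmbedding_level n).prodMap
      (C.measurableEmbedding_level n)).measurableSet_image.2 hW
  have hℓ (n : ℤ) (p) : Prod.map C.map C.map (ℓ n p) = ℓ (n + 1) p := rfl
  have hinj : Function.Injective (Prod.map C.map C.map) := C.map.injective.prodMap C.map.injective
  have hinv : Prod.map C.map C.map ⁻¹' (⋃ n, ℓ n '' W 0) = ⋃ n, ℓ n '' W 0 := by
    ext q
    simp only [mem_preimage, mem_iUnion, mem_image]
    constructor
    · rintro ⟨n, p, hp, e⟩
      refine ⟨n - 1, p, hp, hinj ?_⟩
      rw [hℓ, sub_add_cancel, e]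
    · rintro ⟨n, p, hp, rfl⟩
      exact ⟨n + 1, p, hp, rfl⟩
  rcases h _ hA hinv with h₀ | h₀
  · refine prod_seqMeasure_fam_ne_inter_ne_zero 0 (measure_mono_null (fun p hp ↦ ?_)
      (le_zero_iff.1 ((C.prod_seqMeasure_preimage_level_le 0 0 hA).trans_eq h₀)))
    exact mem_iUnion.2 ⟨0, p, hp, rfl⟩
  · refine prod_seqMeasure_fam_ne_inter_ne_zero 1 (measure_mono_null (fun p hp ↦ ?_)
      (le_zero_iff.1 ((C.prod_seqMeasure_preimage_level_le 0 0 hA.compl).trans_eq h₀)))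
    rintro hq
    obtain ⟨n, p', hp', e⟩ := mem_iUnion.1 hq
    have := (C.eq_of_level_eq hp'.1 (congrArg Prod.fst e) (congrArg Prod.snd e) 0).1
      (sub_eq_zero.1 hp'.2).symm
    have h₁ := hp.2
    rw [this, sub_self] at h₁
    exact absurd h₁ (by decide)

end Cutting

/-- There is an infinite nonatomic σ-finite measure space and an invertible
measure-preserving transformation of it which is weak doubly ergodic, at least
1/2-partially rigid, all of whose finite cartesian products are conservative, but whose
cartesian square is not ergodic. -/
theorem exists_WDE_halfRigid_allProductsConservative_squareNotErgodic :
    ∃ (X : Type) (_ : MeasurableSpace X) (μ : Measure X) (_ : SigmaFinite μ) (T : X ≃ᵐ X),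
      (∀ x : X, μ {x} = 0) ∧ μ Set.univ = ∞ ∧
      MeasurePreserving T μ μ ∧
      WDE μ T ∧
      AtLeastPartiallyRigid μ T (1 / 2) ∧
      (∀ k : ℕ, 1 ≤ k →
        IsConservative (Measure.pi (fun _ : Fin k => μ)) (fun x i => T (x i))) ∧
      ¬ IsErgodicT (μ.prod μ) (Prod.map T T) := by
  refine ⟨cutting.cocycle.Tower, inferInstance, cutting.measure, inferInstance, cutting.map,
    cutting.measure_singleton, cutting.measure_univ, cutting.measurePreserving_map,
    cutting.map_wde, cutting.map_partiallyRigid, fun k _ ↦ cutting.pi_map_isConservative,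
    cutting.map_prod_not_isErgodicT⟩
end

section
/- There exist a σ-finite measure space (X,μ) with μ nonatomic and μ(X) = ∞, and an invertible measure-preserving transformation T of (X,μ), such that: (i) T is rigid; (ii) T is weak doubly ergodic; (iii) for every k ≥ 1 the k-fold Cartesian product T × ⋯ × T is conservative with respect to the k-fold product measure; and (iv) the Cartesian square T × T is not ergodic with respect to μ × μ. -/
open MeasureTheory Filter Set
open scoped ENNReal

/-- `T` is rigid with respect to `μ`. -/
def Rigid {X : Type*} [MeasurableSpace X] (μ : Measure X) (T : X → X) : Prop :=
  ∀ A : Set X, MeasurableSet A → μ A < ∞ →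
    ∃ n : ℕ → ℕ, StrictMono n ∧
      Filter.Tendsto (fun m : ℕ => μ (A ∩ T^[n m] '' A)) Filter.atTop (nhds (μ A))

namespace RigidWDE

open scoped symmDiff

/-- The alphabet of the `k`-th digit. -/
abbrev Dig (k : ℕ) : Type := ZMod (32 * (k + 1))

/-- The growth scale of the `k`-th digit. -/
def tau : ℕ → ℤ
  | 0 => 1
  | k + 1 => 8000 * (k + 1) * tau k

/-- A sequence of integers taking each value along an arithmetic progression of indices. -/
def jseq (m : ℕ) : ℤ := Equiv.intEquivNat.symm (padicValNat 2 m)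

/-- The number of digits at stage `k` forming an arithmetic progression of heights. -/
def apLen (k : ℕ) : ℕ := 32 * k + 28

/-- The coarse height of a digit. -/
def coarse (k : ℕ) (p : Dig k) : ℤ :=
  if p.val < apLen k then p.val
  else if p.val = apLen k then 10 * (32 * (k + 1))
  else if p.val = apLen k + 1 then 11 * (32 * (k + 1))
  else if p.val = apLen k + 2 then 13 * (32 * (k + 1))
  else 14 * (32 * (k + 1))

/-- The height of a digit. -/
def height (k : ℕ) (p : Dig k) : ℤ :=
  4 * tau k * coarse k p + if p.val = apLen k + 2 then jseq k else 0

/-- A bound for the sum of four heights of `k`-th digits. -/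
def spread (k : ℕ) : ℤ := 7200 * (k + 1) * tau k

lemma tau_gt (k : ℕ) : 2 * (k : ℤ) < tau k := by
  induction k with
  | zero => simp [tau]
  | succ k ih =>
    simp only [tau]
    push_cast
    nlinarith [mul_nonneg (Int.natCast_nonneg k) (by linarith : (0:ℤ) ≤ tau k)]

lemma tau_pos (k : ℕ) : 0 < tau k := by have := tau_gt k; omega

lemma two_tau_lt (k : ℕ) : 2 * tau k < tau (k + 1) := by
  simp only [tau]
  nlinarith [mul_nonneg (Int.natCast_nonneg k) (tau_pos k).le, tau_pos k]

lemma tau_strictMono : StrictMono tau :=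
  strictMono_nat_of_lt_succ fun k => by have := two_tau_lt k; have := tau_pos k; omega

lemma sum_spread_le (k : ℕ) : ∑ l ∈ Finset.range k, spread l ≤ tau k := by
  induction k with
  | zero => simp [tau]
  | succ k ih =>
    rw [Finset.sum_range_succ]
    simp only [tau, spread] at *
    nlinarith [mul_nonneg (Int.natCast_nonneg k) (tau_pos k).le, tau_pos k]

lemma abs_jseq_lt (k : ℕ) : 2 * |jseq k| < tau k := by
  have h1 : ∀ n : ℕ, |Equiv.intEquivNat.symm n| ≤ n := by
    intro n
    rcases Nat.even_or_odd' n with ⟨m, rfl | rfl⟩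
    · simp [Equiv.intEquivNat, Equiv.natSumNatEquivNat, Equiv.intEquivNatSumNat,
        Equiv.boolProdEquivSum]
      omega
    · simp [Equiv.intEquivNat, Equiv.natSumNatEquivNat, Equiv.intEquivNatSumNat,
        Equiv.boolProdEquivSum, Int.negSucc_eq]
      grind
  have h2 : padicValNat 2 k ≤ k := by
    rcases Nat.eq_zero_or_pos k with rfl | hk
    · simp
    · exact (padicValNat_le_nat_log k).trans (Nat.log_le_self 2 k)
  have h3 := h1 (padicValNat 2 k)
  have := tau_gt k
  unfold jseq
  have : (padicValNat 2 k : ℤ) ≤ k := by exact_mod_cast h2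
  omega

lemma val_lt_apLen_add (k : ℕ) (p : Dig k) : p.val < apLen k + 4 := by
  have := ZMod.val_lt p
  unfold apLen; omega

lemma coarse_mem (k : ℕ) (p : Dig k) : 0 ≤ coarse k p ∧ coarse k p ≤ 448 * (k + 1) := by
  unfold coarse apLen
  split_ifs <;> constructor <;> omega

lemma coarse_injective (k : ℕ) : Function.Injective (coarse k) := by
  intro p q h
  apply ZMod.val_injective
  have := val_lt_apLen_add k p
  have := val_lt_apLen_add k q
  unfold coarse at h
  unfold apLen at *
  split_ifs at h <;> omega

/-- Not both digits are exceptional. -/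
def Good (k : ℕ) (p q : Dig k) : Prop := p.val < apLen k ∨ q.val < apLen k

lemma exceptional_indicator_eq {k : ℕ} {p q p' q' : Dig k} (h : Good k p q) (h' : Good k p' q')
    (e : coarse k p - coarse k q = coarse k p' - coarse k q') :
    ((if p.val = apLen k + 2 then 1 else 0 : ℤ) - if q.val = apLen k + 2 then 1 else 0) =
      (if p'.val = apLen k + 2 then 1 else 0) - if q'.val = apLen k + 2 then 1 else 0 := by
  have := val_lt_apLen_add k p
  have := val_lt_apLen_add k q
  have := val_lt_apLen_add k p'
  have := val_lt_apLen_add k q'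
  unfold Good at h h'
  unfold coarse at e
  unfold apLen at *
  generalize p.val = a at *
  generalize q.val = b at *
  generalize p'.val = c at *
  generalize q'.val = d at *
  rcases h with h | h <;> rcases h' with h' | h' <;> simp only [h, h', if_true] at e ⊢ <;>
  grind

lemma height_eq (k : ℕ) (p : Dig k) :
    height k p = 4 * tau k * coarse k p + (if p.val = apLen k + 2 then 1 else 0) * jseq k := by
  unfold height; split_ifs <;> simp

lemma abs_height_sub_le (k : ℕ) (p q : Dig k) :
    2 * |height k p - height k q| ≤ spread k := by
  have hp := coarse_mem k p
  have hq := coarse_mem k q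
  have hj := abs_jseq_lt k
  have ht := tau_pos k
  have h1 := mul_le_mul_of_nonneg_left hp.2 ht.le
  have h2 := mul_le_mul_of_nonneg_left hq.2 ht.le
  have h3 := mul_nonneg ht.le hp.1
  have h4 := mul_nonneg ht.le hq.1
  have h5 := mul_nonneg ht.le (Int.natCast_nonneg k)
  obtain ⟨hj1, hj2⟩ := abs_lt.1 (show |jseq k| < tau k by have := abs_nonneg (jseq k); omega)
  have : |height k p - height k q| ≤ 3600 * (k + 1) * tau k := by
    rw [abs_le]
    unfold height
    split_ifs <;> constructor <;> nlinarith
  unfold spread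
  linarith

lemma abs_height_sub_gt {k : ℕ} {p q : Dig k} (h : p ≠ q) :
    3 * tau k < |height k p - height k q| := by
  have hj := abs_jseq_lt k
  have ht := tau_pos k
  have hc : 1 ≤ |coarse k p - coarse k q| := by
    rw [← Int.zero_add 1, Int.add_one_le_iff, abs_pos, sub_ne_zero]
    exact fun e => h (coarse_injective k e)
  have : 4 * tau k ≤ |4 * tau k * (coarse k p - coarse k q)| := by
    rw [abs_mul, abs_of_pos (by linarith : 0 < 4 * tau k)]; nlinarith
  have e : height k p - height k q = 4 * tau k * (coarse k p - coarse k q) +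
      ((if p.val = apLen k + 2 then 1 else 0) - (if q.val = apLen k + 2 then 1 else 0)) * jseq k := by
    rw [height_eq, height_eq]; ring
  rw [e]
  split_ifs <;> simp only [sub_self, sub_zero, zero_sub, zero_mul, one_mul, add_zero, neg_mul] <;> grind

lemma abs_height_sub_sub_gt {k : ℕ} {p q p' q' : Dig k} (h : Good k p q) (h' : Good k p' q')
    (hne : (height k p - height k q) - (height k p' - height k q') ≠ 0) :
    tau k < |(height k p - height k q) - (height k p' - height k q')| := by
  have hj := abs_jseq_lt k
  have ht := tau_pos k
  set β := (coarse k p - coarse k q) - (coarse k p' - coarse k q') with hβ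
  have e : (height k p - height k q) - (height k p' - height k q') = 4 * tau k * β +
      (((if p.val = apLen k + 2 then 1 else 0) - (if q.val = apLen k + 2 then 1 else 0)) -
      ((if p'.val = apLen k + 2 then 1 else 0) - (if q'.val = apLen k + 2 then 1 else 0)))
        * jseq k := by
    simp only [height_eq, hβ]; ring
  by_cases hb : β = 0
  · exfalso
    apply hne
    rw [e, hb, exceptional_indicator_eq h h' (by linarith)]
    simp
  have : 4 * tau k ≤ |4 * tau k * β| := by
    rw [abs_mul, abs_of_pos (by linarith : 0 < 4 * tau k)]
    have : 1 ≤ |β| := by rw [← Int.zero_add 1, Int.add_one_le_iff, abs_pos]; exact hb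
    nlinarith
  rw [e]
  unfold Good at h h'
  have hnp : ∀ a : ℕ, a < apLen k → a ≠ apLen k + 2 := by omega
  rcases h with h | h <;> rcases h' with h' | h' <;> simp only [hnp _ h, hnp _ h', if_false] <;>
  split_ifs <;> norm_num <;> grind

/-- The space of digit sequences. -/
abbrev Seq : Type := ∀ k, Dig k

/-- The uniform probability measure on the digits. -/
noncomputable def unif (k : ℕ) : Measure (Dig k) := ((32 * (k + 1) : ℕ) : ℝ≥0∞)⁻¹ • Measure.count

instance (k : ℕ) : IsProbabilityMeasure (unif k) where
  measure_univ := by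
    have : ((32 * (k + 1) : ℕ) : ℝ≥0∞) ≠ 0 := by positivity
    have h : (Measure.count (univ : Set (Dig k))) = ((32 * (k + 1) : ℕ) : ℝ≥0∞) := by
      rw [Measure.count_univ, ENat.card_eq_coe_fintype_card, ZMod.card]
      rfl
    rw [unif, Measure.smul_apply, h, smul_eq_mul, ENNReal.inv_mul_cancel this (ENNReal.natCast_ne_top _)]

lemma unif_singleton (k : ℕ) (c : Dig k) : unif k {c} = ((32 * (k + 1) : ℕ) : ℝ≥0∞)⁻¹ := by
  simp [unif]

lemma map_add_left_unif (k : ℕ) (c : Dig k) : (unif k).map (c + ·) = unif k := by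
  refine Measure.ext_of_singleton fun a => ?_
  rw [Measure.map_apply (by fun_prop) (by measurability), unif_singleton]
  have : (c + ·) ⁻¹' {a} = {-c + a} := by ext x; simp [eq_neg_add_iff_add_eq]
  rw [this, unif_singleton]

/-- The product of the uniform measures. -/
noncomputable def P : Measure Seq := Measure.infinitePi unif

instance : IsProbabilityMeasure P := by unfold P; infer_instance

instance : P.IsAddLeftInvariant where
  map_add_left_eq_self g := by
    have := Measure.infinitePi_map_pi unif (f := fun k (x : Dig k) => g k + x) (by fun_prop)
    simp only [map_add_left_unif] at this
    exact this

instance (k : ℕ) : (Measure.pi (fun _ : Fin k => P)).IsAddLeftInvariant :=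
  Measure.pi.isAddLeftInvariant _

lemma P_digit (k : ℕ) (S : Set (Dig k)) : P {y | y k ∈ S} = unif k S :=
  (measurePreserving_eval_infinitePi unif k).measure_preimage
    (MeasurableSet.of_discrete (s := S)).nullMeasurableSet

lemma unif_finset (k : ℕ) (S : Finset (Dig k)) :
    unif k S = S.card * ((32 * (k + 1) : ℕ) : ℝ≥0∞)⁻¹ := by
  simp [unif, mul_comm]

/-- Small translations barely move a set, even away from small exceptional sets. -/
lemma tendsto_measure_inter_translate {Z : Type*} [AddCommGroup Z] [TopologicalSpace Z]
    [IsTopologicalAddGroup Z] [CompactSpace Z] [T2Space Z] [MeasurableSpace Z] [BorelSpace Z]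
    (m : Measure Z) [IsFiniteMeasure m] [m.InnerRegular] [m.IsAddLeftInvariant]
    {z : ℕ → Z} (hz : Tendsto z atTop (nhds 0)) {N : ℕ → Set Z}
    (hN : Tendsto (fun n => m (N n)) atTop (nhds 0)) {E : Set Z} (hE : MeasurableSet E) :
    Tendsto (fun n => m (E ∩ ((z n + ·) ⁻¹' E ∩ (N n)ᶜ))) atTop (nhds (m E)) := by
  let f : C(Z × Z, Z) := ⟨fun p => p.1 + p.2, continuous_add⟩
  have h1 : Tendsto (fun n => f.curry (z n)) atTop (nhds (f.curry 0)) :=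
    (f.curry.continuous.tendsto 0).comp hz
  have mp : ∀ w, MeasurePreserving (f.curry w) m m := fun w => measurePreserving_add_left m w
  have h2 := tendsto_measure_symmDiff_preimage_nhds_zero h1
    (Eventually.of_forall fun n => mp (z n)) (mp 0) hE.nullMeasurableSet (measure_ne_top m E)
  have h0 : (f.curry 0) ⁻¹' E = E := by ext x; simp [f]
  rw [h0] at h2
  have h3 : Tendsto (fun n => m E - (m (((f.curry (z n)) ⁻¹' E) ∆ E) + m (N n))) atTop
      (nhds (m E)) := by
    have := ENNReal.Tendsto.sub (tendsto_const_nhds (x := m E) (f := (atTop : Filter ℕ)))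
      (h2.add hN) (Or.inl (measure_ne_top m E))
    simpa using this
  refine tendsto_of_tendsto_of_tendsto_of_le_of_le h3 tendsto_const_nhds (fun n => ?_)
    (fun n => measure_mono inter_subset_left)
  refine tsub_le_iff_right.2 ?_
  calc m E ≤ m ((E ∩ ((z n + ·) ⁻¹' E ∩ (N n)ᶜ)) ∪ ((((f.curry (z n)) ⁻¹' E) ∆ E) ∪ N n)) := by
        refine measure_mono fun x hx => ?_
        by_cases hxN : x ∈ N n
        · exact Or.inr (Or.inr hxN)
        by_cases hx2 : z n + x ∈ E
        · exact Or.inl ⟨hx, hx2, hxN⟩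
        · exact Or.inr (Or.inl (Or.inr ⟨hx, hx2⟩))
    _ ≤ _ := (measure_union_le _ _).trans (by gcongr; exact measure_union_le _ _)

/-- The group of finitely supported digit changes. -/
abbrev Fin0 : Type := Π₀ k, Dig k

lemma dense_range_coe : Dense (range (fun g : Fin0 => (g : Seq))) := by
  intro y
  refine mem_closure_of_tendsto (b := atTop)
    (f := fun n : ℕ => ((DFinsupp.mk (Finset.range n) fun k => y k : Fin0) : Seq))
    (tendsto_pi_nhds.2 fun k => tendsto_const_nhds.congr' ?_)
    (Eventually.of_forall fun n => mem_range_self _)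
  filter_upwards [eventually_gt_atTop k] with n hn
  simp [DFinsupp.mk_apply, hn]

instance : ErgodicVAdd Seq Seq P := instErgodicVAddOfIsAddLeftInvariant

lemma exists_pos_translate {A B : Set Seq} (hA : 0 < P A) (hB : MeasurableSet B) (hB0 : 0 < P B) :
    ∃ g : Fin0, 0 < P (A ∩ ((g : Seq) + ·) ⁻¹' B) := by
  by_contra! H
  set S : Set Seq := ⋃ g : Fin0, ((g : Seq) + ·) ⁻¹' B with hS
  have hSm : MeasurableSet S := .iUnion fun g => hB.preimage (by fun_prop)
  have hAS : P (A ∩ S) = 0 := by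
    rw [hS, inter_iUnion, measure_iUnion_null_iff]
    exact fun g => le_antisymm (H g) zero_le
  have hc : EventuallyConst S (ae P) := by
    refine aeconst_of_dense_setOfPred_preimage_vadd_eq (M := Seq) hSm.nullMeasurableSet
      (dense_range_coe.mono ?_)
    rintro _ ⟨g, rfl⟩
    ext y
    simp only [hS, mem_preimage, mem_iUnion, vadd_eq_add]
    constructor
    · rintro ⟨h, hh⟩
      exact ⟨h + g, by simpa [add_assoc] using hh⟩
    · rintro ⟨h, hh⟩
      exact ⟨h - g, by simpa [sub_eq_add_neg, add_assoc] using hh⟩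
  rcases eventuallyConst_set'.1 hc with h | h
  · have : P S = 0 := by rw [measure_congr h]; simp
    refine hB0.ne' (measure_mono_null (fun y hy => ?_) this)
    exact mem_iUnion.2 ⟨0, by simpa using hy⟩
  · have : P (A ∩ S) = P A := by
      refine measure_congr ?_
      have := (ae_eq_refl A).inter h
      simpa using this
    rw [this] at hAS
    exact hA.ne' hAS

lemma measure_add_preimage (g : Seq) (S : Set Seq) : P ((· + g) ⁻¹' S) = P S := by
  have : (· + g : Seq → Seq) = (g + ·) := by ext; simp [add_comm]
  rw [this, measure_preimage_add]

/-- Almost every sequence meets infinitely often any prescribed sets of digits whose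
measures have divergent sum. -/
lemma ae_frequently_digit {t : ∀ k, Set (Dig k)} (h : ∑' k, unif k (t k) = ∞) :
    ∀ᵐ y ∂P, ∃ᶠ k in atTop, y k ∈ t k := by
  have hm : ∀ k, MeasurableSet {y : Seq | y k ∈ t k} := fun k =>
    (measurable_pi_apply k) MeasurableSet.of_discrete
  have hi : ProbabilityTheory.iIndepSet (fun k => {y : Seq | y k ∈ t k}) P := by
    rw [ProbabilityTheory.iIndepSet_iff_meas_biInter hm]
    intro s
    simp only [P_digit]
    rw [← Measure.infinitePi_pi unif (fun i _ => MeasurableSet.of_discrete)]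
    congr 1
    ext y
    simp
  have h1 := ProbabilityTheory.measure_limsup_eq_one hm hi (by simpa only [P_digit] using h)
  have h2 : ∀ᵐ y ∂P, y ∈ limsup (fun k => {y : Seq | y k ∈ t k}) atTop :=
    (prob_compl_eq_zero_iff (.measurableSet_limsup hm)).2 h1
  filter_upwards [h2] with y hy
  simpa [mem_limsup_iff_frequently_mem] using hy

lemma exists_swap {E : Set Seq} (hE : MeasurableSet E) (hE0 : 0 < P E) {J : Set ℕ}
    (hJ : ∑' k, J.indicator (fun k => ((32 * (k + 1) : ℕ) : ℝ≥0∞)⁻¹) k = ∞) (c d : Seq)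
    (hcd : ∀ k, c k ≠ d k) :
    ∃ m ∈ J, 0 < P {y | y ∈ E ∧ y m = c m ∧ y + Pi.single m (d m - c m) ∈ E} := by
  classical
  by_contra! H
  let t : ∀ k, Set (Dig k) := fun k => if k ∈ J then {c k, d k} else ∅
  have hfreq : ∀ᵐ y ∂P, ∃ᶠ k in atTop, y k ∈ t k := by
    refine ae_frequently_digit (top_unique (hJ ▸ ENNReal.tsum_le_tsum fun k => ?_))
    by_cases hk : k ∈ J
    · simp only [hk, indicator_of_mem, t, if_true]
      rw [← unif_singleton k (c k)]
      exact measure_mono (by simp)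
    · simp [hk]
  obtain ⟨B, hB, hBE⟩ := exists_measure_symmDiff_lt_of_generateFrom_isSetRing (μ := P)
    isSetRing_measurableCylinders
    ⟨{univ}, countable_singleton _, by
      simpa using isSetAlgebra_measurableCylinders.univ_mem, by simp⟩
    generateFrom_measurableCylinders.symm hE hE0
  obtain ⟨I, S, hS, rfl⟩ := (mem_measurableCylinders _).1 hB
  set B : Set Seq := cylinder I S with hBdef
  have hBm : MeasurableSet B := MeasurableSet.cylinder I hS
  obtain ⟨N, hN⟩ : ∃ N, ∀ k ∈ I, k < N := ⟨I.sup id + 1, fun k hk =>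
    Nat.lt_succ_of_le (Finset.le_sup (f := id) hk)⟩
  let F : ℕ → Set Seq := fun m => {y | N ≤ m ∧ y m ∈ t m ∧ ∀ l, N ≤ l → l < m → y l ∉ t l}
  have hFm : ∀ m, MeasurableSet (F m) := by
    intro m
    have hd : ∀ k, MeasurableSet {y : Seq | y k ∈ t k} := fun k =>
      (measurable_pi_apply k) MeasurableSet.of_discrete
    have : F m = {y | N ≤ m} ∩ {y | y m ∈ t m} ∩ ⋂ l, ⋂ (_ : N ≤ l), ⋂ (_ : l < m),
        {y : Seq | y l ∈ t l}ᶜ := by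
      ext y; simp [F, and_assoc]
    rw [this]
    exact ((MeasurableSet.const _).inter (hd m)).inter
      (.iInter fun l => .iInter fun _ => .iInter fun _ => (hd l).compl)
  have hFd : Pairwise (Function.onFun Disjoint F) := by
    have key : ∀ a b, a < b → Disjoint (F a) (F b) := fun a b hab =>
      Set.disjoint_left.2 fun y h1 h2 => h2.2.2 a h1.1 hab h1.2.1
    intro a b hab
    rcases lt_or_gt_of_ne hab with h | h
    · exact key a b h
    · exact (key b a h).symm
  have hFu : ∀ᵐ y ∂P, y ∈ ⋃ m, F m := by
    filter_upwards [hfreq] with y hy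
    have hex : ∃ k, N ≤ k ∧ y k ∈ t k := frequently_atTop.1 hy N
    refine mem_iUnion.2 ⟨Nat.find hex, (Nat.find_spec hex).1, (Nat.find_spec hex).2,
      fun l hl hlt hmem => Nat.find_min hex hlt ⟨hl, hmem⟩⟩
  have hstep : ∀ m, P (E ∩ B ∩ F m) ≤ P (B \ E ∩ F m) := by
    intro m
    by_cases hm : m ∈ J
    swap
    · have : F m = ∅ := by ext y; simp [F, t, hm]
      simp [this]
    set g : Seq := Pi.single m (d m - c m) with hg
    have hgl : ∀ y : Seq, ∀ l, l ≠ m → (y + g) l = y l := fun y l hl => by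
      simp [hg, Pi.single_eq_of_ne hl]
    have hgm : ∀ y : Seq, (y + g) m = y m + (d m - c m) := fun y => by simp [hg]
    let Fc := F m ∩ {y | y m = c m}
    let Fd := F m ∩ {y | y m = d m}
    have hFc : MeasurableSet Fd :=
      (hFm m).inter ((measurable_pi_apply m) (measurableSet_singleton (d m)))
    have hcm : ∀ y, y + g ∈ Fd ↔ y ∈ Fc := by
      intro y
      have h1 : (y + g) m = d m ↔ y m = c m := by
        rw [hgm, ← add_sub_assoc, sub_eq_iff_eq_add, add_comm, add_left_cancel_iff]
      have h2 : ∀ l, l < m → (y + g) l = y l := fun l hl => hgl y l hl.ne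
      simp only [Fc, Fd, F, mem_inter_iff, mem_ofPred_eq, h1]
      constructor
      · rintro ⟨⟨a, -, b⟩, e⟩
        refine ⟨⟨a, by simp [t, hm, e], fun l h3 h4 => ?_⟩, e⟩
        rw [← h2 l h4]; exact b l h3 h4
      · rintro ⟨⟨a, -, b⟩, e⟩
        refine ⟨⟨a, by simp [t, hm, h1.2 e], fun l h3 h4 => ?_⟩, e⟩
        rw [h2 l h4]; exact b l h3 h4
    have hBg : ∀ y, N ≤ m → (y + g ∈ B ↔ y ∈ B) := by
      intro y hNm
      rw [hBdef, mem_cylinder, mem_cylinder]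
      have : I.restrict (y + g) = I.restrict y := by
        ext ⟨k, hk⟩
        exact hgl y k (by have := hN k hk; omega)
      rw [this]
    have hnull : P {y | y ∈ E ∧ y m = c m ∧ y + g ∈ E} = 0 := le_antisymm (H m hm) zero_le
    have e1 : P (E ∩ B ∩ Fc) ≤ P (B \ E ∩ Fd) := by
      rw [← measure_add_preimage g (B \ E ∩ Fd)]
      refine (measure_mono (t := (· + g) ⁻¹' (B \ E ∩ Fd) ∪
        {y | y ∈ E ∧ y m = c m ∧ y + g ∈ E}) ?_).trans
        ((measure_union_le _ _).trans (by rw [hnull, add_zero]))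
      rintro y ⟨⟨h1, h2⟩, h3⟩
      by_cases h4 : y + g ∈ E
      · exact Or.inr ⟨h1, h3.2, h4⟩
      · exact Or.inl ⟨⟨(hBg y h3.1.1).2 h2, h4⟩, (hcm y).2 h3⟩
    have e2 : P (E ∩ B ∩ Fd) ≤ P (B \ E ∩ Fc) := by
      rw [← measure_add_preimage g (E ∩ B ∩ Fd)]
      refine (measure_mono (t := (B \ E ∩ Fc) ∪
        {y | y ∈ E ∧ y m = c m ∧ y + g ∈ E}) ?_).trans
        ((measure_union_le _ _).trans (by rw [hnull, add_zero]))
      rintro y ⟨⟨h1, h2⟩, h3⟩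
      have h3' := (hcm y).1 h3
      by_cases h4 : y ∈ E
      · exact Or.inr ⟨h4, h3'.2, h1⟩
      · exact Or.inl ⟨⟨(hBg y h3.1.1).1 h2, h4⟩, h3'⟩
    have hFu : F m = Fc ∪ Fd := by
      ext y
      simp only [Fc, Fd, mem_union, mem_inter_iff, mem_ofPred_eq, ← and_or_left, iff_self_and]
      intro hy
      simpa [t, hm] using hy.2.1
    have hdisj : Disjoint Fc Fd := Set.disjoint_left.2 fun y h1 h2 =>
      hcd m (h1.2.symm.trans h2.2)
    calc P (E ∩ B ∩ F m) ≤ P (E ∩ B ∩ Fc) + P (E ∩ B ∩ Fd) := by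
          rw [hFu, inter_union_distrib_left]; exact measure_union_le _ _
      _ ≤ P (B \ E ∩ Fc) + P (B \ E ∩ Fd) := by
          rw [add_comm]; exact add_le_add e2 e1
      _ = P (B \ E ∩ F m) := by
          rw [hFu, inter_union_distrib_left, measure_union
            (hdisj.mono inter_subset_right inter_subset_right) ((hBm.diff hE).inter hFc)]
  have hcount : ∀ A : Set Seq, MeasurableSet A → P A = ∑' m, P (A ∩ F m) := by
    intro A hA
    rw [← measure_iUnion (fun a b hab => (hFd hab).mono inter_subset_right inter_subset_right)
      (fun m => hA.inter (hFm m)), ← inter_iUnion]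
    refine measure_congr ?_
    filter_upwards [hFu] with y hy
    exact propext ⟨fun h => ⟨h, hy⟩, fun h => h.1⟩
  have h1 : P (E ∩ B) ≤ P (B \ E) := by
    rw [hcount _ (hE.inter hBm), hcount _ (hBm.diff hE)]
    exact ENNReal.tsum_le_tsum hstep
  refine hBE.not_ge ?_
  rw [Set.symmDiff_def, measure_union (disjoint_sdiff_sdiff) (hE.diff hBm),
    ← measure_inter_add_sdiff E hBm]
  exact add_le_add_left h1 _

lemma tsum_inv_jseq (j : ℤ) :
    ∑' k, {m | jseq m = j}.indicator (fun k => ((32 * (k + 1) : ℕ) : ℝ≥0∞)⁻¹) k = ∞ := by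
  by_contra hne
  set i := Equiv.intEquivNat j with hi
  have hs : ∀ n : ℕ, (n : ZMod (2 ^ (i + 1))) = ((2 ^ i : ℕ) : ZMod (2 ^ (i + 1))) →
      jseq n = j := by
    intro n hn
    rw [ZMod.natCast_eq_natCast_iff] at hn
    have h1 : 2 ^ i ∣ n := (hn.dvd_iff (pow_dvd_pow 2 (Nat.le_succ i))).2 dvd_rfl
    have h2 : ¬ 2 ^ (i + 1) ∣ n := fun h => by
      have := (hn.dvd_iff dvd_rfl).1 h
      exact absurd (Nat.le_of_dvd (by positivity) this)
        (not_le.2 (Nat.pow_lt_pow_right one_lt_two (Nat.lt_succ_self i)))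
    have : padicValNat 2 n = i := by
      have hn0 : n ≠ 0 := fun h => h2 (h ▸ dvd_zero _)
      refine le_antisymm ?_ ?_
      · by_contra! h
        exact h2 ((padicValNat_dvd_iff_le hn0).2 h)
      · exact (padicValNat_dvd_iff_le hn0).1 h1
    rw [jseq, this, hi, Equiv.symm_apply_apply]
  refine Real.not_summable_indicator_one_div_natCast (m := 2 ^ (i + 1)) (by positivity)
    ((2 ^ i : ℕ) : ZMod (2 ^ (i + 1))) ?_
  have h3 := (ENNReal.summable_toReal hne).mul_left 64
  refine Summable.of_nonneg_of_le (fun n => indicator_nonneg (fun _ _ => by positivity) n)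
    (fun n => ?_) h3
  by_cases hn : (n : ZMod (2 ^ (i + 1))) = ((2 ^ i : ℕ) : ZMod (2 ^ (i + 1)))
  · rw [indicator_of_mem (by exact hn), indicator_of_mem (by exact hs n hn)]
    rcases Nat.eq_zero_or_pos n with rfl | hpos
    · simp
    · rw [ENNReal.toReal_inv, ENNReal.toReal_natCast, ← div_eq_mul_inv,
        div_le_div_iff₀ (by positivity) (by positivity)]
      have : (1 : ℝ) ≤ n := by exact_mod_cast hpos
      push_cast
      linarith
  · rw [indicator_of_notMem (by exact hn)]
    positivity

/-- A finitely supported sum is dominated by its last nonzero term. -/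
lemma exists_top_term {D : ℕ → ℤ} (hf : D.HasFiniteSupport) (h0 : D ≠ 0)
    (hs : ∀ l, |D l| ≤ spread l) :
    ∃ k, D k ≠ 0 ∧ |∑ᶠ l, D l - D k| ≤ ∑ l ∈ Finset.range k, spread l := by
  have hf : D.support.Finite := hf
  have hne : hf.toFinset.Nonempty := by
    obtain ⟨k, hk⟩ := Function.ne_iff.1 h0
    exact ⟨k, by simpa using hk⟩
  set k := hf.toFinset.max' hne
  have hk : D k ≠ 0 := by simpa using hf.toFinset.max'_mem hne
  have hsum : ∑ᶠ l, D l = ∑ l ∈ Finset.range (k + 1), D l := by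
    refine finsum_eq_sum_of_support_subset _ fun l hl => ?_
    simpa [Nat.lt_succ_iff] using hf.toFinset.le_max' l (by simpa using hl)
  have h1 : |∑ᶠ l, D l - D k| ≤ ∑ l ∈ Finset.range k, |D l| := by
    rw [hsum, Finset.sum_range_succ, add_sub_cancel_right]
    exact Finset.abs_sum_le_sum_abs _ _
  exact ⟨k, hk, h1.trans (Finset.sum_le_sum fun l _ => hs l)⟩

/-- The height changes caused digitwise by a translation. -/
def rise (g : Fin0) (y : Seq) (k : ℕ) : ℤ := height k (g k + y k) - height k (y k)

lemma rise_hasFiniteSupport (g : Fin0) (y : Seq) : (rise g y).HasFiniteSupport := by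
  refine g.support.finite_toSet.subset fun k hk => ?_
  by_contra h
  have : g k = 0 := by simpa using h
  exact hk (by simp [rise, this])

lemma rise_eq_zero_iff {g : Fin0} {y : Seq} {k : ℕ} : rise g y k = 0 ↔ g k = 0 := by
  constructor
  · intro h
    by_contra hg
    have := abs_height_sub_gt (k := k) (p := g k + y k) (q := y k) (by simpa using hg)
    rw [rise] at h
    rw [h] at this
    have := tau_pos k
    simp at *
    omega
  · intro h; simp [rise, h]

lemma abs_rise_le (g : Fin0) (y : Seq) (k : ℕ) : 2 * |rise g y k| ≤ spread k :=
  abs_height_sub_le _ _ _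

/-- The total height change caused by a translation. -/
noncomputable def hgt (g : Fin0) (y : Seq) : ℤ := ∑ᶠ k, rise g y k

lemma hgt_eq_sum (g : Fin0) (y : Seq) : hgt g y = ∑ k ∈ g.support, rise g y k := by
  refine finsum_eq_sum_of_support_subset _ fun k hk => ?_
  simpa using fun h => hk (rise_eq_zero_iff.2 h)

@[simp] lemma hgt_zero (y : Seq) : hgt 0 y = 0 := by simp [hgt_eq_sum]

lemma hgt_add (g g' : Fin0) (y : Seq) : hgt (g + g') y = hgt g (g' + y) + hgt g' y := by
  rw [hgt, hgt, hgt, ← finsum_add_distrib (rise_hasFiniteSupport _ _) (rise_hasFiniteSupport _ _)]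
  refine finsum_congr fun k => ?_
  simp [rise, add_assoc]

lemma measurable_hgt (g : Fin0) : Measurable (hgt g) := by
  have : hgt g = fun y => ∑ k ∈ g.support, rise g y k := funext (hgt_eq_sum g)
  rw [this]
  refine Finset.measurable_sum _ fun k _ => ?_
  exact (Measurable.of_discrete (f := fun p : Dig k => height k (g k + p) - height k p)).comp
    (measurable_pi_apply k)

lemma hgt_single (m : ℕ) (p : Dig m) (y : Seq) :
    hgt (DFinsupp.single m p) y = height m (p + y m) - height m (y m) := by
  rw [hgt, finsum_eq_single _ m]
  · simp [rise]
  · intro k hk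
    exact rise_eq_zero_iff.2 (DFinsupp.single_eq_of_ne hk)

lemma spread_nonneg (k : ℕ) : 0 ≤ spread k := by
  have := tau_pos k
  unfold spread
  positivity

lemma exists_top_rise {g : Fin0} (hg : g ≠ 0) (y : Seq) :
    ∃ k, 3 * tau k < |rise g y k| ∧ |hgt g y - rise g y k| ≤ tau k := by
  obtain ⟨k, hk, h⟩ := exists_top_term (rise_hasFiniteSupport g y)
    (fun h => hg (DFinsupp.ext fun k => rise_eq_zero_iff.1 (congrFun h k)))
    (fun l => by have := abs_rise_le g y l; have := abs_nonneg (rise g y l); omega)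
  refine ⟨k, abs_height_sub_gt ?_, h.trans (sum_spread_le k)⟩
  simpa [rise_eq_zero_iff] using hk

lemma hgt_ne_zero {g : Fin0} (hg : g ≠ 0) (y : Seq) : hgt g y ≠ 0 := by
  obtain ⟨k, h1, h2⟩ := exists_top_rise hg y
  have := tau_pos k
  intro h
  rw [h, zero_sub, abs_neg] at h2
  omega

/-- Some height differences never occur along an orbit. -/
lemma hgt_ne_two_tau_sub {J K : ℕ} (hJK : J < K) (g : Fin0) (y : Seq) :
    hgt g y ≠ 2 * tau K - 2 * tau J := by
  have hJ := tau_pos J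
  have h3 : 2 * tau J < tau K := (two_tau_lt J).trans_le (tau_strictMono.monotone hJK)
  intro h
  rcases eq_or_ne g 0 with rfl | hg
  · simp at h; omega
  obtain ⟨k, h1, h2⟩ := exists_top_rise hg y
  rw [abs_le] at h2
  rcases le_or_gt K k with hk | hk
  · have := tau_strictMono.monotone hk
    rcases lt_abs.1 h1 with h1 | h1 <;> omega
  · have h4 := tau_strictMono.monotone (show k + 1 ≤ K from hk)
    have h5 := sum_spread_le (k + 1)
    rw [Finset.sum_range_succ] at h5
    have h6 : tau k ≤ spread k := by
      unfold spread
      nlinarith [tau_pos k, mul_nonneg (Int.natCast_nonneg k) (tau_pos k).le]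
    have h7 := abs_rise_le g y k
    have h8 : 0 ≤ ∑ l ∈ Finset.range k, spread l := Finset.sum_nonneg fun l _ => spread_nonneg l
    have h9 : 3 * tau k < spread k := by have := abs_nonneg (rise g y k); omega
    have := le_abs_self (rise g y k)
    omega

/-- Two pairs of good digit sequences related by translations of equal total height have the same
height differences at the first digit. -/
lemma rise_zero_eq {g g' : Fin0} {x y : Seq} (h : ∀ k, 1 ≤ k → Good k (x k) (y k))
    (h' : ∀ k, 1 ≤ k → Good k (g k + x k) (g' k + y k)) (e : hgt g x = hgt g' y) :
    rise g x 0 = rise g' y 0 := by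
  by_contra hne
  set D : ℕ → ℤ := fun k => rise g x k - rise g' y k with hD
  have hsum : ∑ᶠ k, D k = 0 := by
    rw [hD, finsum_sub_distrib (rise_hasFiniteSupport _ _) (rise_hasFiniteSupport _ _)]
    exact sub_eq_zero.2 e
  obtain ⟨k, hk, hk2⟩ := exists_top_term (D := D)
    (((rise_hasFiniteSupport g x).union (rise_hasFiniteSupport g' y)).subset
      (Function.support_sub _ _))
    (fun h0 => hne (sub_eq_zero.1 (congrFun h0 0)))
    (fun l => by
      have := abs_rise_le g x l
      have := abs_rise_le g' y l
      have := abs_sub (rise g x l) (rise g' y l)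
      simp only [hD]; omega)
  rw [hsum, zero_sub, abs_neg] at hk2
  rcases Nat.eq_zero_or_pos k with rfl | hpos
  · simp at hk2
    exact hk hk2
  · have e2 : D k = (height k (g k + x k) - height k (g' k + y k)) -
        (height k (x k) - height k (y k)) := by simp only [hD, rise]; ring
    rw [e2] at hk hk2
    exact absurd (abs_height_sub_sub_gt (h' k hpos) (h k hpos) hk)
      (not_lt.2 (hk2.trans (sum_spread_le k)))

/-- Digit sequences together with an integer level. -/
def Sk : Type := Seq × ℤ

/-- The point at level `i` over a digit sequence. -/
def pt (y : Seq) (i : ℤ) : Sk := (y, i)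

instance : MeasurableSpace Sk := inferInstanceAs (MeasurableSpace (Seq × ℤ))

/-- The product of the measure on digit sequences and the counting measure on levels. -/
noncomputable def nu : Measure Sk := P.prod (Measure.count : Measure ℤ)

noncomputable instance : AddAction Fin0 Sk where
  vadd g p := ((g : Seq) + p.1, p.2 - hgt g p.1)
  zero_vadd p := Prod.ext (zero_add p.1) (by
    change p.2 - hgt 0 p.1 = p.2
    simp)
  add_vadd g g' p := Prod.ext (by
      change ((g + g' : Fin0) : Seq) + p.1 = (g : Seq) + ((g' : Seq) + p.1)
      rw [DFinsupp.coe_add, add_assoc]) (by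
    change p.2 - hgt (g + g') p.1 = p.2 - hgt g' p.1 - hgt g (g' + p.1)
    rw [hgt_add]; ring)

lemma vadd_mk (g : Fin0) (y : Seq) (i : ℤ) :
    g +ᵥ pt y i = pt ((g : Seq) + y) (i - hgt g y) := rfl

lemma vadd_snd (g : Fin0) (p : Sk) : (g +ᵥ p).2 = p.2 - hgt g p.1 := rfl

lemma measurable_fst' : Measurable (fun p : Sk => p.1) := measurable_fst (α := Seq) (β := ℤ)

lemma measurable_snd' : Measurable (fun p : Sk => p.2) := measurable_snd (α := Seq) (β := ℤ)

lemma count_map_sub (n : ℤ) : (Measure.count : Measure ℤ).map (fun i => i - n) = Measure.count := by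
  refine Measure.ext_of_singleton fun a => ?_
  rw [Measure.map_apply (by fun_prop) (by measurability)]
  have : (fun i => i - n) ⁻¹' {a} = {a + n} := by ext x; simp [sub_eq_iff_eq_add]
  rw [this]; simp

lemma measurePreserving_vadd' (g : Fin0) : MeasurePreserving (fun p : Sk => g +ᵥ p) nu nu := by
  refine MeasurePreserving.skew_product (α := Seq) (γ := ℤ) (β := Seq) (δ := ℤ)
    (f := fun y => (g : Seq) + y) (g := fun y i => i - hgt g y)
    (measurePreserving_add_left P (g : Seq)) ?_ (ae_of_all _ fun y => count_map_sub _)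
  exact measurable_snd.sub ((measurable_hgt g).comp measurable_fst)

instance : MeasurableConstVAdd Fin0 Sk := ⟨fun g => (measurePreserving_vadd' g).measurable⟩

instance : VAddInvariantMeasure Fin0 Sk nu :=
  ⟨fun g _ hs => (measurePreserving_vadd' g).measure_preimage hs.nullMeasurableSet⟩

lemma vadd_eq_of_snd_eq {g : Fin0} {p : Sk} (h : (g +ᵥ p).2 = p.2) : g = 0 := by
  by_contra hg
  rw [vadd_snd] at h
  exact hgt_ne_zero hg p.1 (by omega)

/-- The points whose level is the closest to `i` in their orbit. -/
def dom (i : ℤ) : Set Sk :=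
  {p | ∀ g : Fin0, Equiv.intEquivNat (p.2 - i) ≤ Equiv.intEquivNat ((g +ᵥ p).2 - i)}

lemma measurableSet_dom (i : ℤ) : MeasurableSet (dom i) := by
  have : dom i = ⋂ g : Fin0,
    {p | Equiv.intEquivNat (p.2 - i) ≤ Equiv.intEquivNat ((g +ᵥ p).2 - i)} := by
    ext p; simp [dom]
  rw [this]
  have hm : Measurable (fun j : ℤ => Equiv.intEquivNat (j - i)) := .of_discrete
  exact .iInter fun g => measurableSet_le (hm.comp measurable_snd')
    (hm.comp (measurable_snd'.comp (measurable_const_vadd g)))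

lemma existsUnique_vadd_mem_dom (i : ℤ) (p : Sk) : ∃! g : Fin0, g +ᵥ p ∈ dom i := by
  obtain ⟨_, ⟨g, rfl⟩, hg⟩ := wellFounded_lt.has_min
    (range fun g : Fin0 => Equiv.intEquivNat ((g +ᵥ p).2 - i)) (range_nonempty _)
  have hmem : g +ᵥ p ∈ dom i := fun g' => by
    rw [← add_vadd]
    exact not_lt.1 (hg _ ⟨g' + g, rfl⟩)
  refine ⟨g, hmem, fun g' hg' => ?_⟩
  have h1 := hmem (g' - g)
  have h2 := hg' (g - g')
  rw [← add_vadd, sub_add_cancel] at h1 h2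
  have h3 := Equiv.intEquivNat.injective (le_antisymm h2 h1)
  have h4 : ((g' - g) +ᵥ (g +ᵥ p)).2 = (g +ᵥ p).2 := by
    rw [← add_vadd, sub_add_cancel]; omega
  exact sub_eq_zero.1 (vadd_eq_of_snd_eq h4)

lemma isAddFundamentalDomain_dom (i : ℤ) : IsAddFundamentalDomain Fin0 (dom i) nu :=
  .mk' (measurableSet_dom i).nullMeasurableSet (existsUnique_vadd_mem_dom i)

lemma mk_mem_dom (y : Seq) (i : ℤ) : (pt y i) ∈ dom i := by
  intro g
  have : Equiv.intEquivNat 0 = 0 := by decide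
  change Equiv.intEquivNat (i - i) ≤ _
  rw [sub_self, this]
  exact Nat.zero_le _

lemma nu_apply {S : Set Sk} (hS : MeasurableSet S) :
    nu S = ∑' i : ℤ, P {y | (pt y i) ∈ S} := by
  rw [← lintegral_count]
  exact Measure.prod_apply_symm (α := Seq) (β := ℤ) hS

/-- The space of orbits. -/
def X : Type := Quotient (AddAction.orbitRel Fin0 Sk)

instance : MeasurableSpace X :=
  inferInstanceAs (MeasurableSpace (Quotient (AddAction.orbitRel Fin0 Sk)))

/-- The projection to the space of orbits. -/
noncomputable def proj (p : Sk) : X := Quotient.mk _ p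

lemma measurable_proj : Measurable proj :=
  measurable_quotient_mk' (s := AddAction.orbitRel Fin0 Sk)

lemma measurableSet_iff {A : Set X} : MeasurableSet A ↔ MeasurableSet (proj ⁻¹' A) := Iff.rfl

lemma proj_eq_iff {p q : Sk} : proj p = proj q ↔ ∃ g : Fin0, g +ᵥ q = p :=
  Quotient.eq (r := AddAction.orbitRel Fin0 Sk)

lemma proj_vadd (g : Fin0) (p : Sk) : proj (g +ᵥ p) = proj p := proj_eq_iff.2 ⟨g, rfl⟩

/-- The measure on the space of orbits. -/
noncomputable def mu : Measure X := (nu.restrict (dom 0)).map proj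

lemma mu_apply (i : ℤ) {A : Set X} (hA : MeasurableSet A) :
    mu A = nu (proj ⁻¹' A ∩ dom i) := by
  rw [mu, Measure.map_apply measurable_proj hA, Measure.restrict_apply (measurable_proj hA)]
  refine (isAddFundamentalDomain_dom 0).measure_set_eq (isAddFundamentalDomain_dom i)
    (measurable_proj hA) fun g => ?_
  ext p
  simp [proj_vadd]

/-- The copy of the space of digit sequences at level `i`. -/
noncomputable def lev (i : ℤ) (y : Seq) : X := proj (pt y i)

lemma measurable_lev (i : ℤ) : Measurable (lev i) :=
  measurable_proj.comp (measurable_prodMk_right (α := Seq) (β := ℤ))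

lemma lev_injective (i : ℤ) : Function.Injective (lev i) := by
  intro y y' h
  obtain ⟨g, hg⟩ := proj_eq_iff.1 h
  have : g = 0 := vadd_eq_of_snd_eq (p := (pt y' i)) (by rw [hg]; rfl)
  rw [this, zero_vadd] at hg
  exact (congrArg Prod.fst hg).symm

lemma lev_add (i : ℤ) (g : Fin0) (y : Seq) : lev i ((g : Seq) + y) = lev (i + hgt g y) y := by
  have := proj_vadd g (pt y (i + hgt g y))
  rwa [vadd_mk, add_sub_cancel_right] at this

lemma lev_eq_iff {i j : ℤ} {x y : Seq} :
    lev i x = lev j y ↔ ∃ g : Fin0, (g : Seq) + y = x ∧ i = j - hgt g y := by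
  refine proj_eq_iff.trans (exists_congr fun g => ?_)
  rw [vadd_mk]
  exact Prod.mk_inj.trans (and_congr Iff.rfl eq_comm)

lemma exists_lev (a : X) : ∃ i y, lev i y = a := by
  obtain ⟨p, rfl⟩ : ∃ p, proj p = a := Quotient.exists_rep a
  exact ⟨p.2, p.1, rfl⟩

lemma preimage_image_lev (i : ℤ) (E : Set Seq) :
    proj ⁻¹' (lev i '' E) = ⋃ g : Fin0, {p : Sk | (g +ᵥ p).1 ∈ E ∧ (g +ᵥ p).2 = i} := by
  ext p
  simp only [mem_preimage, mem_image, mem_iUnion, mem_ofPred_eq]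
  constructor
  · rintro ⟨y, hy, h⟩
    obtain ⟨g, hg⟩ := proj_eq_iff.1 h
    exact ⟨g, by rw [hg]; exact hy, by rw [hg]; rfl⟩
  · rintro ⟨g, h1, h2⟩
    refine ⟨(g +ᵥ p).1, h1, ?_⟩
    rw [← h2, ← proj_vadd g p]
    rfl

lemma measurableEmbedding_lev (i : ℤ) : MeasurableEmbedding (lev i) where
  injective := lev_injective i
  measurable := measurable_lev i
  measurableSet_image' := by
    intro E hE
    rw [measurableSet_iff, preimage_image_lev]
    refine .iUnion fun g => ?_
    exact (measurable_fst'.comp (measurable_const_vadd g) hE).inter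
      (measurable_snd'.comp (measurable_const_vadd g) (measurableSet_singleton i))

lemma mu_image_lev (i : ℤ) {E : Set Seq} (hE : MeasurableSet E) : mu (lev i '' E) = P E := by
  rw [mu_apply i ((measurableEmbedding_lev i).measurableSet_image.2 hE)]
  have : proj ⁻¹' (lev i '' E) ∩ dom i = E ×ˢ ({i} : Set ℤ) := by
    ext p
    constructor
    · rintro ⟨⟨y, hy, h⟩, hp⟩
      obtain ⟨g, hg⟩ := proj_eq_iff.1 h
      have h0 : g = 0 := (existsUnique_vadd_mem_dom i p).unique (hg ▸ mk_mem_dom y i)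
        (by rwa [zero_vadd])
      rw [h0, zero_vadd] at hg
      rw [hg]
      exact ⟨hy, rfl⟩
    · rintro ⟨h1, h2⟩
      obtain ⟨y, j⟩ := p
      obtain rfl : j = i := h2
      exact ⟨⟨y, h1, rfl⟩, mk_mem_dom y j⟩
  rw [this]
  refine (Measure.prod_prod (μ := P) (ν := (Measure.count : Measure ℤ)) _ _).trans ?_
  simp

lemma mu_inter_range_lev (i : ℤ) {A : Set X} (hA : MeasurableSet A) :
    mu (A ∩ range (lev i)) = P (lev i ⁻¹' A) := by
  rw [← image_preimage_eq_inter_range, mu_image_lev i (measurable_lev i hA)]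

lemma restrict_range_lev (i : ℤ) : mu.restrict (range (lev i)) = P.map (lev i) := by
  ext A hA
  rw [Measure.restrict_apply hA, mu_inter_range_lev i hA, Measure.map_apply (measurable_lev i) hA]

lemma iUnion_range_lev : ⋃ i, range (lev i) = univ :=
  eq_univ_of_forall fun a => by
    obtain ⟨i, y, rfl⟩ := exists_lev a
    exact mem_iUnion.2 ⟨i, mem_range_self y⟩

lemma exists_slice_pos {A : Set X} (hA : MeasurableSet A) (h : 0 < mu A) :
    ∃ i, 0 < P (lev i ⁻¹' A) := by
  by_contra! H
  refine h.ne' ?_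
  rw [← inter_univ A, ← iUnion_range_lev, inter_iUnion, measure_iUnion_null_iff]
  intro i
  rw [mu_inter_range_lev i hA]
  exact le_antisymm (H i) zero_le

lemma pos_of_slice_pos {A : Set X} {i : ℤ} {E : Set Seq} (hE : 0 < P E)
    (h : E ⊆ lev i ⁻¹' A) (hEm : MeasurableSet E): 0 < mu A := by
  rw [← mu_image_lev i hEm] at hE
  exact hE.trans_le (measure_mono (image_subset_iff.2 h))

instance : SigmaFinite mu := by
  refine ⟨⟨⟨fun n => range (lev (Equiv.intEquivNat.symm n)), fun _ => trivial, fun n => ?_, ?_⟩⟩⟩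
  · rw [← image_univ, mu_image_lev _ MeasurableSet.univ]
    exact measure_lt_top _ _
  · rw [← iUnion_range_lev]
    exact Equiv.intEquivNat.symm.surjective.iUnion_comp fun i => range (lev i)

/-- The shift of levels by `n`. -/
noncomputable def shift (n : ℤ) : X → X :=
  Quotient.map (fun p : Sk => pt p.1 (p.2 + n)) (by
    rintro p q ⟨g, rfl⟩
    refine ⟨g, ?_⟩
    change pt ((g : Seq) + q.1) (q.2 + n - hgt g q.1) = pt ((g : Seq) + q.1) (q.2 - hgt g q.1 + n)
    rw [sub_add_eq_add_sub])

lemma shift_lev (n i : ℤ) (y : Seq) : shift n (lev i y) = lev (i + n) y := rfl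

lemma shift_shift (m n : ℤ) (a : X) : shift m (shift n a) = shift (n + m) a := by
  obtain ⟨i, y, rfl⟩ := exists_lev a
  simp only [shift_lev, add_assoc]

lemma shift_zero (a : X) : shift 0 a = a := by
  obtain ⟨i, y, rfl⟩ := exists_lev a
  simp [shift_lev]

lemma measurable_raise (n : ℤ) : Measurable (fun p : Sk => pt p.1 (p.2 + n)) :=
  measurable_fst'.prodMk (measurable_snd'.add_const n)

lemma measurable_shift (n : ℤ) : Measurable (shift n) :=
  measurable_from_quotient.2 (measurable_proj.comp (measurable_raise n))

/-- The transformation raising levels by one. -/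
noncomputable def T : X ≃ᵐ X where
  toFun := shift 1
  invFun := shift (-1)
  left_inv a := by rw [shift_shift]; exact shift_zero a
  right_inv a := by rw [shift_shift]; exact shift_zero a
  measurable_toFun := measurable_shift 1
  measurable_invFun := measurable_shift (-1)

lemma T_iterate (n : ℕ) : (T : X → X)^[n] = shift n := by
  induction n with
  | zero => ext a; exact (shift_zero a).symm
  | succ n ih =>
    ext a
    rw [Function.iterate_succ_apply', ih]
    exact (shift_shift 1 n a).trans (by norm_cast)

lemma shift_image (n : ℤ) (A : Set X) : shift n '' A = shift (-n) ⁻¹' A := by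
  refine congrFun (image_eq_preimage_of_inverse (fun a => ?_) (fun a => ?_)) A <;>
  rw [shift_shift] <;> simp [shift_zero]

lemma measurePreserving_shift (n : ℤ) : MeasurePreserving (shift n) mu mu := by
  refine ⟨measurable_shift n, Measure.ext fun A hA => ?_⟩
  have hr : MeasurePreserving (fun p : Sk => pt p.1 (p.2 + n)) nu nu := by
    refine (MeasurePreserving.id P).prod (μc := (Measure.count : Measure ℤ)) (f := id)
      (g := fun i : ℤ => i + n) ⟨by fun_prop, ?_⟩
    simpa using count_map_sub (-n)
  rw [Measure.map_apply (measurable_shift n) hA, mu_apply 0 (measurable_shift n hA),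
    mu_apply n hA]
  refine Eq.trans ?_ (hr.measure_preimage
    ((measurable_proj hA).inter (measurableSet_dom n)).nullMeasurableSet)
  congr 1
  ext ⟨y, j⟩
  refine and_congr Iff.rfl (forall_congr' fun g => ?_)
  change Equiv.intEquivNat (j - 0) ≤ Equiv.intEquivNat (j - hgt g y - 0) ↔
    Equiv.intEquivNat (j + n - n) ≤ Equiv.intEquivNat (j + n - hgt g y - n)
  rw [add_sub_cancel_right, add_sub_right_comm, add_sub_cancel_right, sub_zero, sub_zero]

lemma P_digit_eq (k : ℕ) (c : Dig k) : P {y | y k = c} = ((32 * (k + 1) : ℕ) : ℝ≥0∞)⁻¹ :=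
  (P_digit k {c}).trans (unif_singleton k c)

lemma tendsto_alphabet_inv :
    Tendsto (fun k : ℕ => ((32 * (k + 1) : ℕ) : ℝ≥0∞)⁻¹) atTop (nhds 0) :=
  ENNReal.tendsto_inv_nat_nhds_zero.comp
    (tendsto_atTop_mono (fun k => show k ≤ 32 * (k + 1) by omega) tendsto_id)

lemma mu_singleton (a : X) : mu {a} = 0 := by
  obtain ⟨i, y, rfl⟩ := exists_lev a
  rw [← image_singleton, mu_image_lev i (measurableSet_singleton y)]
  refine le_antisymm (ge_of_tendsto' tendsto_alphabet_inv fun k => ?_) zero_le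
  rw [← P_digit_eq k (y k)]
  exact measure_mono (by simp)

lemma mu_univ : mu univ = ∞ := by
  have hd : Pairwise (Function.onFun Disjoint fun K => range (lev (2 * tau K))) := by
    have key : ∀ J K, J < K → Disjoint (range (lev (2 * tau J))) (range (lev (2 * tau K))) := by
      intro J K hJK
      refine Set.disjoint_left.2 ?_
      rintro _ ⟨x, rfl⟩ ⟨y, hy⟩
      obtain ⟨g, -, hg⟩ := lev_eq_iff.1 hy.symm
      exact hgt_ne_two_tau_sub hJK g y (by omega)
    intro J K hJK
    rcases lt_or_gt_of_ne hJK with h | h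
    · exact key J K h
    · exact (key K J h).symm
  refine top_unique (le_trans ?_ (measure_mono (subset_univ (⋃ K, range (lev (2 * tau K))))))
  rw [measure_iUnion hd fun K => (measurableEmbedding_lev _).measurableSet_range]
  have : ∀ K, mu (range (lev (2 * tau K))) = 1 := fun K => by
    rw [← image_univ, mu_image_lev _ MeasurableSet.univ, measure_univ]
  simp only [this]
  rw [ENNReal.tsum_const_eq_top_of_ne_zero one_ne_zero]

lemma height_one_add {m : ℕ} {p : Dig m} (hp : p.val + 1 < apLen m) :
    height m (1 + p) - height m p = 4 * tau m := by
  have h1 : (1 + p).val = p.val + 1 := by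
    have : Fact (1 < 32 * (m + 1)) := ⟨by omega⟩
    have h := ZMod.val_one (32 * (m + 1))
    rw [ZMod.val_add_of_lt (by rw [h]; unfold apLen at hp; omega), h, Nat.add_comm]
  have h2 : p.val < apLen m := by omega
  have h3 : p.val ≠ apLen m + 2 := by omega
  have h4 : p.val + 1 ≠ apLen m + 2 := by omega
  simp only [height, coarse, h1, hp, h2, h3, h4, if_true, if_false]
  push_cast; ring

/-- The sequences whose `m`-th digit has no successor in the progression. -/
def lastDigits (m : ℕ) : Set Seq := {y | ¬ (y m).val + 1 < apLen m}

lemma P_lastDigits_le (m : ℕ) : P (lastDigits m) ≤ 5 * ((32 * (m + 1) : ℕ) : ℝ≥0∞)⁻¹ := by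
  have h1 : P (lastDigits m) =
      unif m ((Finset.univ.filter fun p : Dig m => ¬ p.val + 1 < apLen m : Finset (Dig m))) := by
    rw [← P_digit]; congr 1; ext y; simp [lastDigits]
  rw [h1, unif_finset]
  gcongr
  have h2 : (Finset.univ.filter fun p : Dig m => ¬ p.val + 1 < apLen m).card ≤
      (Finset.Ico (apLen m - 1) (apLen m + 4)).card := by
    refine Finset.card_le_card_of_injOn ZMod.val (fun p hp => ?_) (ZMod.val_injective _).injOn
    have := val_lt_apLen_add m p
    simp at hp ⊢
    omega
  have h3 : (Finset.Ico (apLen m - 1) (apLen m + 4)).card = 5 := by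
    rw [Nat.card_Ico]; unfold apLen; omega
  rw [h3] at h2
  exact_mod_cast h2

lemma tendsto_P_lastDigits : Tendsto (fun m => P (lastDigits m)) atTop (nhds 0) := by
  have h := ENNReal.Tendsto.const_mul (a := 5) tendsto_alphabet_inv (Or.inr (by simp))
  rw [mul_zero] at h
  exact tendsto_of_tendsto_of_tendsto_of_le_of_le tendsto_const_nhds h (fun _ => zero_le)
    P_lastDigits_le

/-- The sequence with a single digit `1`, at place `m`. -/
noncomputable def oneAt (m : ℕ) : Fin0 := DFinsupp.single m 1

lemma tendsto_oneAt : Tendsto (fun m => (oneAt m : Seq)) atTop (nhds 0) := by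
  refine tendsto_pi_nhds.2 fun k => tendsto_const_nhds.congr' ?_
  filter_upwards [eventually_gt_atTop k] with m hm
  exact (DFinsupp.single_eq_of_ne (β := Dig) hm.ne).symm

lemma lev_oneAt_add {m : ℕ} {y : Seq} (hy : y ∉ lastDigits m) (i : ℤ) :
    lev i ((oneAt m : Seq) + y) = lev (i + 4 * tau m) y := by
  rw [lev_add, oneAt, hgt_single, height_one_add (not_not.1 hy)]

/-- The times of rigidity. -/
def rigidTime (m : ℕ) : ℕ := (4 * tau m).toNat

lemma rigidTime_cast (m : ℕ) : (rigidTime m : ℤ) = 4 * tau m :=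
  Int.toNat_of_nonneg (by have := tau_pos m; omega)

lemma rigidTime_strictMono : StrictMono rigidTime := fun a b h => by
  have := tau_strictMono h
  zify
  rw [rigidTime_cast, rigidTime_cast]
  omega

lemma tendsto_mu_inter_shift {A : Set X} (hA : MeasurableSet A) (hfin : mu A < ∞) :
    Tendsto (fun m => mu (A ∩ shift (4 * tau m) ⁻¹' A)) atTop (nhds (mu A)) := by
  let E : ℤ → Set Seq := fun i => {y | lev i y ∈ A ∧ pt y i ∈ dom 0}
  have hE : ∀ i, MeasurableSet (E i) := fun i => (measurable_lev i hA).inter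
    (measurable_prodMk_right (α := Seq) (β := ℤ) (measurableSet_dom 0))
  have hsum : ∀ B : Set X, MeasurableSet B →
      mu B = ∫⁻ i, P {y | lev i y ∈ B ∧ pt y i ∈ dom 0} ∂Measure.count := by
    intro B hB
    rw [mu_apply 0 hB, nu_apply ((measurable_proj hB).inter (measurableSet_dom 0)),
      lintegral_count]
    rfl
  have hlim : Tendsto (fun m => ∫⁻ i, P (E i ∩ (((oneAt m : Seq) + ·) ⁻¹' E i ∩ (lastDigits m)ᶜ))
      ∂Measure.count) atTop (nhds (mu A)) := by
    rw [hsum A hA]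
    refine tendsto_lintegral_of_dominated_convergence (fun i => P (E i))
      (fun m => .of_discrete) (fun m => ae_of_all _ fun i => measure_mono inter_subset_left)
      (by rw [← hsum A hA]; exact hfin.ne) (ae_of_all _ fun i => ?_)
    exact tendsto_measure_inter_translate P tendsto_oneAt tendsto_P_lastDigits (hE i)
  refine tendsto_of_tendsto_of_tendsto_of_le_of_le hlim tendsto_const_nhds (fun m => ?_)
    (fun m => measure_mono inter_subset_left)
  simp only
  rw [hsum _ (hA.inter (measurable_shift _ hA))]
  refine lintegral_mono fun i => measure_mono ?_
  rintro y ⟨h1, h2, h3⟩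
  refine ⟨⟨h1.1, ?_⟩, h1.2⟩
  rw [mem_preimage, shift_lev, ← lev_oneAt_add h3]
  exact h2.1

lemma pi_inter_range {k : ℕ} (i : Fin k → ℤ) {A : Set (Fin k → X)} (hA : MeasurableSet A) :
    Measure.pi (fun _ => mu) (A ∩ univ.pi fun j => range (lev (i j))) =
      Measure.pi (fun _ => P) ((fun (y : Fin k → Seq) j => lev (i j) (y j)) ⁻¹' A) := by
  rw [← Measure.restrict_apply hA, Measure.restrict_pi_pi]
  simp only [restrict_range_lev]
  rw [← Measure.pi_map_pi fun j => (measurable_lev (i j)).aemeasurable]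
  exact Measure.map_apply (measurable_pi_lambda _ fun j =>
    (measurable_lev (i j)).comp (measurable_pi_apply j)) hA

lemma exists_pi_recurrence {k : ℕ} {A : Set (Fin k → X)} (hA : MeasurableSet A)
    (hA0 : 0 < Measure.pi (fun _ => mu) A) :
    ∃ m, 0 < Measure.pi (fun _ => mu) (A ∩ (fun a j => shift (4 * tau m) (a j)) ⁻¹' A) := by
  obtain ⟨i, hi⟩ : ∃ i : Fin k → ℤ,
      0 < Measure.pi (fun _ => mu) (A ∩ univ.pi fun j => range (lev (i j))) := by
    by_contra! H
    refine hA0.ne' (measure_mono_null (t := ⋃ i : Fin k → ℤ,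
      A ∩ univ.pi fun j => range (lev (i j))) (fun a ha => ?_)
      (measure_iUnion_null fun i => le_antisymm (H i) zero_le))
    choose i y hy using fun j => exists_lev (a j)
    exact mem_iUnion.2 ⟨i, ha, fun j _ => ⟨y j, hy j⟩⟩
  set L : (Fin k → Seq) → Fin k → X := fun y j => lev (i j) (y j) with hL
  have hLm : Measurable L := measurable_pi_lambda _ fun j =>
      (measurable_lev (i j)).comp (measurable_pi_apply j)
  have hN : Tendsto (fun m => Measure.pi (fun _ : Fin k => P) {y | ∃ j, y j ∈ lastDigits m})
      atTop (nhds 0) := by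
    have h := ENNReal.Tendsto.const_mul (a := (k : ℝ≥0∞)) tendsto_P_lastDigits
      (Or.inr (ENNReal.natCast_ne_top k))
    rw [mul_zero] at h
    refine tendsto_of_tendsto_of_tendsto_of_le_of_le tendsto_const_nhds h (fun _ => zero_le)
      fun m => ?_
    have hm : MeasurableSet (lastDigits m) := measurable_pi_apply m
      (MeasurableSet.of_discrete (s := {p : Dig m | ¬ p.val + 1 < apLen m}))
    calc Measure.pi (fun _ : Fin k => P) {y | ∃ j, y j ∈ lastDigits m}
        ≤ Measure.pi (fun _ : Fin k => P) (⋃ j, Function.eval j ⁻¹' lastDigits m) :=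
          measure_mono fun y hy => by simpa using hy
      _ ≤ ∑ j : Fin k, Measure.pi (fun _ : Fin k => P) (Function.eval j ⁻¹' lastDigits m) :=
          measure_iUnion_fintype_le _ _
      _ = k * P (lastDigits m) := by
          simp [(measurePreserving_eval (fun _ : Fin k => P) _).measure_preimage
            hm.nullMeasurableSet]
  have hz : Tendsto (fun m => (fun _ => (oneAt m : Seq) : Fin k → Seq)) atTop (nhds 0) :=
    tendsto_pi_nhds.2 fun _ => tendsto_oneAt
  have hlim := tendsto_measure_inter_translate (Measure.pi fun _ : Fin k => P) hz hN (hLm hA)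
  rw [pi_inter_range i hA] at hi
  obtain ⟨m, hm⟩ := (hlim.eventually (lt_mem_nhds hi)).exists
  refine ⟨m, lt_of_lt_of_le ?_ (measure_mono (inter_subset_left (t :=
    univ.pi fun j => range (lev (i j)))))⟩
  have hAm : MeasurableSet ((fun (a : Fin k → X) j => shift (4 * tau m) (a j)) ⁻¹' A) :=
    (measurable_pi_lambda _ fun j => (measurable_shift _).comp (measurable_pi_apply j)) hA
  rw [pi_inter_range i (hA.inter hAm)]
  refine hm.trans_le (measure_mono ?_)
  rintro y ⟨h1, h2, h3⟩
  refine ⟨h1, ?_⟩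
  have h4 : ∀ j, y j ∉ lastDigits m := fun j hj => h3 ⟨j, hj⟩
  have : (fun j => shift (4 * tau m) (L y j)) = L ((fun _ => (oneAt m : Seq)) + y) := by
    ext j
    simp only [hL, shift_lev, Pi.add_apply]
    exact (lev_oneAt_add (h4 j) (i j)).symm
  change (fun j => shift (4 * tau m) (L y j)) ∈ A
  rw [this]
  exact h2

/-- The exceptional digits. -/
def exc (m a : ℕ) : Dig m := ((apLen m + a : ℕ) : Dig m)

lemma exc_val (m : ℕ) {a : ℕ} (ha : a < 4) : (exc m a).val = apLen m + a :=
  ZMod.val_natCast_of_lt (by unfold apLen; omega)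

lemma height_exc_three_sub (m : ℕ) :
    height m (exc m 1) - height m (exc m 3) = -(384 * (m + 1) * tau m) := by
  simp only [height, coarse, exc_val m (show 1 < 4 by omega), exc_val m (show 3 < 4 by omega)]
  norm_num
  ring

lemma height_exc_two_sub (m : ℕ) :
    height m (exc m 0) - height m (exc m 2) = -(384 * (m + 1) * tau m) - jseq m := by
  simp only [height, coarse, exc_val m (show 0 < 4 by omega), exc_val m (show 2 < 4 by omega)]
  norm_num
  ring

lemma exc_ne (m : ℕ) {a b : ℕ} (ha : a < 4) (hb : b < 4) (hab : a ≠ b) : exc m a ≠ exc m b := by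
  intro h
  have := congrArg ZMod.val h
  rw [exc_val m ha, exc_val m hb] at this
  omega

lemma lev_add_single (i : ℤ) {m : ℕ} {y : Seq} {c : Dig m} (d : Dig m) (hy : y m = c) :
    lev i (y + Pi.single m (d - c)) = lev (i + (height m d - height m c)) y := by
  have := lev_add i (DFinsupp.single m (d - c)) y
  rw [hgt_single, DFinsupp.single_eq_pi_single, add_comm, hy, sub_add_cancel] at this
  exact this

lemma exists_common_slice {A B : Set X} (hA : MeasurableSet A) (hB : MeasurableSet B)
    (hA0 : 0 < mu A) (hB0 : 0 < mu B) :
    ∃ i l, 0 < P (lev i ⁻¹' A ∩ lev l ⁻¹' B) := by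
  obtain ⟨i, hi⟩ := exists_slice_pos hA hA0
  obtain ⟨l, hl⟩ := exists_slice_pos hB hB0
  obtain ⟨g, hg⟩ := exists_pos_translate hi (measurable_lev l hB) hl
  by_contra! H
  refine hg.ne' (measure_mono_null (t := ⋃ h : ℤ, lev i ⁻¹' A ∩ lev (l + h) ⁻¹' B)
    (fun y hy => ?_) (measure_iUnion_null fun h => le_antisymm (H i _) zero_le))
  refine mem_iUnion.2 ⟨hgt g y, hy.1, ?_⟩
  rw [mem_preimage, ← lev_add]
  exact hy.2

lemma exists_double_recurrence {A B : Set X} (hA : MeasurableSet A) (hB : MeasurableSet B)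
    (hA0 : 0 < mu A) (hB0 : 0 < mu B) :
    ∃ n : ℕ, 1 ≤ n ∧ 0 < mu (A ∩ shift n '' A) ∧ 0 < mu (B ∩ shift n '' A) := by
  classical
  obtain ⟨i, l, hE0⟩ := exists_common_slice hA hB hA0 hB0
  set E := lev i ⁻¹' A ∩ lev l ⁻¹' B with hE
  have hEm : MeasurableSet E := (measurable_lev i hA).inter (measurable_lev l hB)
  let S : ∀ m, Dig m → Dig m → Set Seq := fun m c d =>
    {y | y ∈ E ∧ y m = c ∧ y + Pi.single m (d - c) ∈ E}
  have hSm : ∀ m c d, MeasurableSet (S m c d) := fun m c d =>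
    hEm.inter ((measurable_pi_apply m (measurableSet_singleton c)).inter
      (measurable_add_const (Pi.single m (d - c) : Seq) hEm))
  obtain ⟨m, hmj, h1, h2⟩ : ∃ m, jseq m = i - l ∧ 0 < P (S m (exc m 3) (exc m 1)) ∧
      0 < P (S m (exc m 2) (exc m 0)) := by
    by_contra! H
    obtain ⟨m, hm, hpos⟩ := exists_swap hEm hE0 (tsum_inv_jseq (i - l))
      (fun m => if 0 < P (S m (exc m 3) (exc m 1)) then exc m 2 else exc m 3)
      (fun m => if 0 < P (S m (exc m 3) (exc m 1)) then exc m 0 else exc m 1)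
      (fun m => by
        split_ifs
        · exact exc_ne m (by omega) (by omega) (by omega)
        · exact exc_ne m (by omega) (by omega) (by omega))
    by_cases h : 0 < P (S m (exc m 3) (exc m 1))
    · simp only [h, if_true] at hpos
      exact absurd hpos (not_lt.2 (H m hm h))
    · simp only [h, if_false] at hpos
      exact h hpos
  have hn : (0 : ℤ) < 384 * (m + 1) * tau m := by have := tau_pos m; positivity
  have hcast : (((384 * (m + 1) * tau m).toNat : ℕ) : ℤ) = 384 * (m + 1) * tau m :=
    Int.toNat_of_nonneg hn.le
  refine ⟨(384 * (m + 1) * tau m).toNat, by omega, ?_, ?_⟩ <;>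
  rw [shift_image, hcast]
  · refine pos_of_slice_pos h1 (i := i) ?_ (hSm _ _ _)
    rintro y ⟨hy, hym, hy'⟩
    refine ⟨hy.1, ?_⟩
    have := hy'.1
    rwa [mem_preimage, lev_add_single i _ hym, height_exc_three_sub] at this
  · refine pos_of_slice_pos h2 (i := l) ?_ (hSm _ _ _)
    rintro y ⟨hy, hym, hy'⟩
    refine ⟨hy.2, ?_⟩
    have := hy'.1
    rw [mem_preimage, lev_add_single i _ hym, height_exc_two_sub, hmj] at this
    rw [mem_preimage, shift_lev]
    convert this using 2
    ring

/-- The pairs of digit sequences which are good at all places but the first. -/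
def goodPairs : Set (Seq × Seq) := {p | ∀ k, 1 ≤ k → Good k (p.1 k) (p.2 k)}

lemma measurable_digits (k : ℕ) : Measurable fun p : Seq × Seq => (p.1 k, p.2 k) := by fun_prop

lemma measurableSet_goodPairs : MeasurableSet goodPairs := by
  have : goodPairs = ⋂ k, ⋂ (_ : 1 ≤ k), (fun p : Seq × Seq => (p.1 k, p.2 k)) ⁻¹'
      {q | Good k q.1 q.2} := by
    ext p; simp [goodPairs]
  rw [this]
  exact .iInter fun k => .iInter fun _ => measurable_digits k .of_discrete

lemma P_exceptional_le (m : ℕ) :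
    P {y | ¬ (y m).val < apLen m} ≤ 4 * ((32 * (m + 1) : ℕ) : ℝ≥0∞)⁻¹ := by
  have h1 : P {y | ¬ (y m).val < apLen m} =
      unif m ((Finset.univ.filter fun p : Dig m => ¬ p.val < apLen m : Finset (Dig m))) := by
    rw [← P_digit]; congr 1; ext y; simp
  rw [h1, unif_finset]
  gcongr
  have h2 : (Finset.univ.filter fun p : Dig m => ¬ p.val < apLen m).card ≤
      (Finset.Ico (apLen m) (apLen m + 4)).card := by
    refine Finset.card_le_card_of_injOn ZMod.val (fun p hp => ?_) (ZMod.val_injective _).injOn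
    have := val_lt_apLen_add m p
    simp at hp ⊢
    omega
  rw [Nat.card_Ico, Nat.add_sub_cancel_left] at h2
  exact_mod_cast h2

lemma prod_not_good_le (k : ℕ) :
    (P.prod P) {p | ¬ Good k (p.1 k) (p.2 k)} ≤ ENNReal.ofReal (1 / (64 * (k + 1) ^ 2)) := by
  have h1 : {p : Seq × Seq | ¬ Good k (p.1 k) (p.2 k)} =
      {y | ¬ (y k).val < apLen k} ×ˢ {y | ¬ (y k).val < apLen k} := by
    ext p; simp [Good]
  have h2 : ((32 * (k + 1) : ℕ) : ℝ≥0∞)⁻¹ = ENNReal.ofReal (32 * (k + 1))⁻¹ := by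
    rw [ENNReal.ofReal_inv_of_pos (by positivity), ← ENNReal.ofReal_natCast]
    push_cast; rfl
  rw [h1, Measure.prod_prod]
  refine (mul_le_mul' (P_exceptional_le k) (P_exceptional_le k)).trans (le_of_eq ?_)
  have h4 : (4 : ℝ≥0∞) = ENNReal.ofReal 4 := by simp
  rw [h2, h4, ← ENNReal.ofReal_mul (by norm_num), ← ENNReal.ofReal_mul (by positivity)]
  congr 1
  field_simp
  norm_num

lemma tsum_not_good_le :
    ∑' k : ℕ, (P.prod P) {p | ¬ Good (k + 1) (p.1 (k + 1)) (p.2 (k + 1))} ≤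
      ENNReal.ofReal (1 / 64) := by
  refine (ENNReal.tsum_le_tsum fun k => prod_not_good_le (k + 1)).trans ?_
  refine ENNReal.tsum_le_of_sum_range_le fun n => ?_
  rw [← ENNReal.ofReal_sum_of_nonneg fun k _ => by positivity]
  refine ENNReal.ofReal_le_ofReal ?_
  have : ∀ n : ℕ, ∑ k ∈ Finset.range n, (1 : ℝ) / (64 * (((k + 1 : ℕ) : ℝ) + 1) ^ 2) ≤
      (1 : ℝ) / 64 - 1 / (64 * ((n : ℝ) + 1)) := by
    intro n
    induction n with
    | zero => simp
    | succ n ih =>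
      rw [Finset.sum_range_succ]
      have : (1 : ℝ) / (64 * (((n + 1 : ℕ) : ℝ) + 1) ^ 2) ≤
          1 / (64 * ((n : ℝ) + 1)) - 1 / (64 * (((n + 1 : ℕ) : ℝ) + 1)) := by
        push_cast
        rw [div_sub_div _ _ (by positivity) (by positivity),
          div_le_div_iff₀ (by positivity) (by positivity)]
        have : (0 : ℝ) ≤ n := n.cast_nonneg
        nlinarith [mul_nonneg this this, mul_nonneg this (mul_nonneg this this)]
      linarith
  have h := this n
  have : (0 : ℝ) ≤ 1 / (64 * ((n : ℝ) + 1)) := by positivity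
  linarith

lemma prod_inter_goodPairs_pos {S : Set (Seq × Seq)}
    (hS : ENNReal.ofReal (1 / 64) < (P.prod P) S) : 0 < (P.prod P) (goodPairs ∩ S) := by
  by_contra! H
  refine hS.not_ge ?_
  calc (P.prod P) S ≤ (P.prod P) ((goodPairs ∩ S) ∪
        ⋃ k : ℕ, {p | ¬ Good (k + 1) (p.1 (k + 1)) (p.2 (k + 1))}) := by
        refine measure_mono fun p hp => ?_
        by_cases h : p ∈ goodPairs
        · exact Or.inl ⟨h, hp⟩
        · simp only [goodPairs, mem_ofPred_eq, not_forall] at h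
          obtain ⟨k, hk, hk2⟩ := h
          obtain ⟨k, rfl⟩ := Nat.exists_eq_add_of_le' hk
          exact Or.inr (mem_iUnion.2 ⟨k, hk2⟩)
    _ ≤ 0 + ENNReal.ofReal (1 / 64) := (measure_union_le _ _).trans
        (add_le_add H ((measure_iUnion_le _).trans tsum_not_good_le))
    _ = _ := zero_add _

/-- The pairs of digit sequences with the same first digit. -/
def sameFirst : Set (Seq × Seq) := {p | p.1 0 = p.2 0}

lemma measurableSet_sameFirst : MeasurableSet sameFirst :=
  measurable_digits 0 (MeasurableSet.of_discrete (s := {q : Dig 0 × Dig 0 | q.1 = q.2}))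

lemma prod_sameFirst : (P.prod P) sameFirst = ENNReal.ofReal (1 / 32) := by
  rw [Measure.prod_apply measurableSet_sameFirst]
  have : ∀ x : Seq, P (Prod.mk x ⁻¹' sameFirst) = ENNReal.ofReal (1 / 32) := by
    intro x
    have h : Prod.mk x ⁻¹' sameFirst = {y | y 0 = x 0} := by
      ext y; exact eq_comm
    rw [h, P_digit_eq, one_div, ENNReal.ofReal_inv_of_pos (by norm_num)]
    norm_num
  simp [this]

lemma prod_same_pos : 0 < (P.prod P) (goodPairs ∩ sameFirst) :=
  prod_inter_goodPairs_pos (by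
    rw [prod_sameFirst]
    exact (ENNReal.ofReal_lt_ofReal_iff (by norm_num)).2 (by norm_num))

lemma prod_different_pos : 0 < (P.prod P) (goodPairs ∩ sameFirstᶜ) :=
  prod_inter_goodPairs_pos (by
    rw [prob_compl_eq_one_sub measurableSet_sameFirst, prod_sameFirst, ← ENNReal.ofReal_one,
      ← ENNReal.ofReal_sub _ (by norm_num)]
    exact (ENNReal.ofReal_lt_ofReal_iff (by norm_num)).2 (by norm_num))

lemma measurableEmbedding_prodMap_lev :
    MeasurableEmbedding (Prod.map (lev 0) (lev 0)) :=
  (measurableEmbedding_lev 0).prodMap (measurableEmbedding_lev 0)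

lemma prod_image_lev (S : Set (Seq × Seq)) :
    (mu.prod mu) (Prod.map (lev 0) (lev 0) '' S) = (P.prod P) S := by
  have h : (mu.prod mu).restrict (range (Prod.map (lev 0) (lev 0))) =
      (P.prod P).map (Prod.map (lev 0) (lev 0)) := by
    rw [range_prodMap, ← Measure.prod_restrict, restrict_range_lev,
      Measure.map_prod_map _ _ (measurable_lev 0) (measurable_lev 0)]
  rw [← Measure.restrict_eq_self _ (image_subset_range _ S), h,
    measurableEmbedding_prodMap_lev.map_apply,
    preimage_image_eq _ measurableEmbedding_prodMap_lev.injective]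

lemma shift_same_ne_different {x y x' y' : Seq} (h : (x, y) ∈ goodPairs) (h' : (x', y') ∈ goodPairs)
    {n : ℤ} (ex : lev 0 x' = shift n (lev 0 x)) (ey : lev 0 y' = shift n (lev 0 y))
    (e : x' 0 = y' 0) : x 0 = y 0 := by
  rw [shift_lev] at ex ey
  obtain ⟨g, rfl, hg⟩ := lev_eq_iff.1 ex
  obtain ⟨g', rfl, hg'⟩ := lev_eq_iff.1 ey
  have h0 := rise_zero_eq h h' (by omega : hgt g x = hgt g' y)
  simp only [Pi.add_apply] at e
  rw [rise, rise, e] at h0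
  by_contra hne
  have := abs_height_sub_gt hne
  have ht := tau_pos 0
  rw [show height 0 (x 0) - height 0 (y 0) = 0 by linarith, abs_zero] at this
  omega

lemma exists_invariant_square : ∃ W : Set (X × X), MeasurableSet W ∧ Prod.map T T ⁻¹' W = W ∧
    (mu.prod mu) W ≠ 0 ∧ (mu.prod mu) Wᶜ ≠ 0 := by
  set V := Prod.map (lev 0) (lev 0) '' (goodPairs ∩ sameFirst) with hV
  have hVm : MeasurableSet V := measurableEmbedding_prodMap_lev.measurableSet_image.2
    (measurableSet_goodPairs.inter measurableSet_sameFirst)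
  refine ⟨⋃ n : ℤ, Prod.map (shift n) (shift n) ⁻¹' V,
    .iUnion fun n => ((measurable_shift n).prodMap (measurable_shift n)) hVm, ?_, ?_, ?_⟩
  · have hT : ∀ (n : ℤ) (a : X), shift n (T a) = shift (1 + n) a := fun n a => shift_shift n 1 a
    ext ⟨a, b⟩
    simp only [mem_preimage, mem_iUnion, Prod.map_apply, hT]
    exact ⟨fun ⟨n, hn⟩ => ⟨1 + n, hn⟩, fun ⟨n, hn⟩ => ⟨n - 1, by simpa using hn⟩⟩
  · refine (lt_of_lt_of_le prod_same_pos ?_).ne'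
    rw [← prod_image_lev]
    refine measure_mono fun p hp => mem_iUnion.2 ⟨0, ?_⟩
    change Prod.map (shift 0) (shift 0) p ∈ V
    rwa [show Prod.map (shift 0) (shift 0) p = p from Prod.ext (shift_zero _) (shift_zero _)]
  · refine (lt_of_lt_of_le prod_different_pos ?_).ne'
    rw [← prod_image_lev]
    refine measure_mono ?_
    rintro _ ⟨⟨x, y⟩, ⟨hg, hne⟩, rfl⟩ hW
    obtain ⟨n, ⟨x', y'⟩, ⟨hg', he⟩, heq⟩ := mem_iUnion.1 hW
    exact hne (shift_same_ne_different hg hg' (congrArg Prod.fst heq) (congrArg Prod.snd heq) he)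

lemma mu_inter_image_shift (n : ℤ) {A : Set X} (hA : MeasurableSet A) :
    mu (A ∩ shift n '' A) = mu (A ∩ shift n ⁻¹' A) := by
  have h := (measurePreserving_shift n).measure_preimage
    (hA.inter (measurable_shift (-n) hA)).nullMeasurableSet
  rw [shift_image, ← h, preimage_inter, ← preimage_comp, inter_comm]
  have : shift (-n) ∘ shift n = id := by
    ext1 a
    rw [Function.comp_apply, shift_shift, add_neg_cancel, shift_zero, id]
  rw [this, preimage_id]

lemma pi_T_iterate (k n : ℕ) :
    (fun (x : Fin k → X) i => T (x i))^[n] = fun x i => shift n (x i) := by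
  rw [← T_iterate]
  exact Pi.map_iterate (fun _ : Fin k => (T : X → X)) n

end RigidWDE

/-- There is an infinite nonatomic σ-finite measure space and an invertible
measure-preserving transformation of it which is rigid, weak doubly ergodic, all of whose
finite cartesian products are conservative, but whose cartesian square is not ergodic. -/
theorem exists_rigid_WDE_allProductsConservative_squareNotErgodic :
    ∃ (X : Type) (_ : MeasurableSpace X) (μ : Measure X) (_ : SigmaFinite μ) (T : X ≃ᵐ X),
      (∀ x : X, μ {x} = 0) ∧ μ Set.univ = ∞ ∧
      MeasurePreserving T μ μ ∧
      WDE μ T ∧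
      Rigid μ T ∧
      (∀ k : ℕ, 1 ≤ k →
        IsConservative (Measure.pi (fun _ : Fin k => μ)) (fun x i => T (x i))) ∧
      ¬ IsErgodicT (μ.prod μ) (Prod.map T T) := by
  refine ⟨RigidWDE.X, inferInstance, RigidWDE.mu, inferInstance, RigidWDE.T,
    RigidWDE.mu_singleton, RigidWDE.mu_univ, RigidWDE.measurePreserving_shift 1, ?_, ?_, ?_, ?_⟩
  · intro A B hA hB hA0 hB0
    obtain ⟨n, hn, h⟩ := RigidWDE.exists_double_recurrence hA hB hA0 hB0
    refine ⟨n, hn, ?_⟩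
    rwa [RigidWDE.T_iterate]
  · intro A hA hfin
    refine ⟨RigidWDE.rigidTime, RigidWDE.rigidTime_strictMono, ?_⟩
    simpa only [RigidWDE.T_iterate, RigidWDE.mu_inter_image_shift _ hA, RigidWDE.rigidTime_cast]
      using RigidWDE.tendsto_mu_inter_shift hA hfin
  · intro k _ A hA hA0
    obtain ⟨m, hm⟩ := RigidWDE.exists_pi_recurrence hA hA0
    refine ⟨RigidWDE.rigidTime m, ?_, ?_⟩
    · have h1 := RigidWDE.rigidTime_cast m
      have h2 := RigidWDE.tau_pos m
      omega
    · rwa [RigidWDE.pi_T_iterate, RigidWDE.rigidTime_cast]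
  · intro h
    obtain ⟨W, hW, hinv, h1, h2⟩ := RigidWDE.exists_invariant_square
    exact (h W hW hinv).elim h1 h2
end
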